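/- Let 𝒫 = {0, p₁, …, p_n} be a finite rooted homeomorphically irreducible tree with root 0, and let p₁, …, p_k be the minimal elements of 𝒫 \ {0}. Let Σ_𝒫 be the function such that Σ_𝒫(a₁, …, a_n) = |SStar(D)| whenever D is a semilocal finite-dimensional Prüfer domain with hiSpec(D) ≅ 𝒫 (via an isomorphism matching pᵢ with Pᵢ) and ω(Pᵢ) = aᵢ for each i (this is well defined). Then, for every choice of positive integers b_{k+1}, …, b_n, the function π_𝒫(X₁, …, X_k) := Σ_𝒫(X₁, …, X_k, b_{k+1}, …, b_n) is a polynomial (with rational coefficients) of total degree k·2^{k−1}. -/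

import Mathlib

/- Common background: Prüfer domains, semistar and (fractional) star operations,
standard decomposition, skeleton, supports, `hiSpec`, the rings `Z(P)`,
and the invariants `ω` and `ε`, following Spirito,
"Semistar operations on semilocal Prüfer domains". -/

set_option linter.unusedSectionVars false
set_option maxHeartbeats 1000000

open Pointwise

noncomputable section

namespace Paper

variable (D : Type*) [CommRing D] [IsDomain D]
variable (K : Type*) [Field K] [Algebra D K] [IsFractionRing D K]

/-- The localization of `D` at a prime ideal `P`, viewed as an overring of `D`
inside its quotient field `K`. -/
def locAt (P : Ideal D) (hP : P.IsPrime) : Subalgebra D K :=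
  Localization.subalgebra K (@Ideal.primeCompl D _ P hP)
    (fun _ hx => mem_nonZeroDivisors_of_ne_zero fun h => hx (h ▸ P.zero_mem))

/-- A Prüfer domain: every localization at a prime ideal is a valuation domain
(any two elements are comparable w.r.t. divisibility). -/
def IsPrufer : Prop :=
  ∀ (P : Ideal D) (hP : P.IsPrime), ∀ x y : locAt D K P hP, ∃ z, x * z = y ∨ y * z = x

/-- A semilocal ring: finitely many maximal ideals. -/
def IsSemilocal : Prop := {I : Ideal D | I.IsMaximal}.Finite

/-- Two ideals are dependent if some nonzero prime ideal is contained in both. -/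
def Dependent (M N : Ideal D) : Prop :=
  ∃ P : Ideal D, P.IsPrime ∧ P ≠ ⊥ ∧ P ≤ M ∧ P ≤ N

/-- The member of the standard decomposition corresponding to the dependence class
of the maximal ideal `M`: the intersection of the localizations of `D` at the
maximal ideals dependent on `M`. -/
def TOf (M : Ideal D) : Subalgebra D K :=
  sInf {A | ∃ (N : Ideal D) (hN : N.IsMaximal), Dependent D M N ∧ A = locAt D K N hN.isPrime}

/-- The standard decomposition of `D`. -/
def stdDecomp : Set (Subalgebra D K) :=
  {T | ∃ M : Ideal D, M.IsMaximal ∧ T = TOf D K M}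

/-- The skeleton of `Over(D)`: all intersections of subsets of the standard
decomposition (including the empty intersection `K` and the total one `D`). -/
def SkOver : Set (Subalgebra D K) :=
  {A | ∃ S ⊆ stdDecomp D K, A = sInf S}

/-- `I` is a fractional ideal of the overring `A` of `D`: it is an `A`-submodule
of `K` and `dI ⊆ A` for some nonzero `d ∈ K`. -/
def IsFracOf (A : Subalgebra D K) (I : Submodule D K) : Prop :=
  (∀ a ∈ A, ∀ x ∈ I, a * x ∈ I) ∧ ∃ d : K, d ≠ 0 ∧ ∀ x ∈ I, d * x ∈ A

end Paper

namespace Paper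

/-- A semistar operation on a domain `R` with quotient field `K`: an extensive,
order-preserving, idempotent self-map of the set of `R`-submodules of `K` such
that `(xI)^⋆ = x·I^⋆` for every nonzero `x ∈ K`. -/
structure Semistar (R : Type*) [CommRing R] (K : Type*) [Field K] [Algebra R K] where
  toFun : Submodule R K → Submodule R K
  le_star' : ∀ I, I ≤ toFun I
  mono' : ∀ ⦃I J⦄, I ≤ J → toFun I ≤ toFun J
  idem' : ∀ I, toFun (toFun I) = toFun I
  smul' : ∀ (x : K), x ≠ 0 → ∀ I,
    toFun (Submodule.span R {x} * I) = Submodule.span R {x} * toFun I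

namespace Semistar

variable {R : Type*} [CommRing R] {K : Type*} [Field K] [Algebra R K]

theorem ext' {s t : Semistar R K} (h : s.toFun = t.toFun) : s = t := by
  cases s; cases t; cases h; rfl

instance : PartialOrder (Semistar R K) where
  le s t := ∀ I, s.toFun I ≤ t.toFun I
  le_refl _ _ := le_rfl
  le_trans _ _ _ hab hbc I := (hab I).trans (hbc I)
  le_antisymm _ _ h h' := ext' (funext fun I => le_antisymm (h I) (h' I))

end Semistar

/-- The identity semistar operation `d`. -/
def dOp (R : Type*) [CommRing R] (K : Type*) [Field K] [Algebra R K] : Semistar R K where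
  toFun I := I
  le_star' _ := le_rfl
  mono' _ _ h := h
  idem' _ := rfl
  smul' _ _ _ := rfl

end Paper

namespace Paper

variable (D : Type*) [CommRing D] [IsDomain D]
variable (K : Type*) [Field K] [Algebra D K] [IsFractionRing D K]

/-- A fractional star operation on an overring `A` of `D` (inside `K`): a
semistar-like closure operation defined on the fractional ideals of `A`.
In particular `FracStar D K ⊥` is the set of fractional star operations on `D`. -/
structure FracStar (A : Subalgebra D K) where
  toFun : {I : Submodule D K // IsFracOf D K A I} → {I : Submodule D K // IsFracOf D K A I}
  le_star' : ∀ I, I.1 ≤ (toFun I).1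
  mono' : ∀ I J, I.1 ≤ J.1 → (toFun I).1 ≤ (toFun J).1
  idem' : ∀ I, toFun (toFun I) = toFun I
  smul' : ∀ (x : K), x ≠ 0 → ∀ I J, J.1 = Submodule.span D {x} * I.1 →
    (toFun J).1 = Submodule.span D {x} * (toFun I).1

namespace FracStar

variable {D K} {A : Subalgebra D K}

theorem ext' {s t : FracStar D K A} (h : s.toFun = t.toFun) : s = t := by
  cases s; cases t; cases h; rfl

instance : PartialOrder (FracStar D K A) where
  le s t := ∀ I, (s.toFun I).1 ≤ (t.toFun I).1
  le_refl _ _ := le_rfl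
  le_trans _ _ _ hab hbc I := (hab I).trans (hbc I)
  le_antisymm _ _ h h' := ext' (funext fun I => Subtype.ext (le_antisymm (h I) (h' I)))

end FracStar

/-- A fractional star operation on the overring `A` is a *star operation* if it
closes `A` itself. -/
def FracStar.IsStarOp {A : Subalgebra D K} (f : FracStar D K A) : Prop :=
  ∀ h : IsFracOf D K A (Subalgebra.toSubmodule A),
    (f.toFun ⟨Subalgebra.toSubmodule A, h⟩).1 = Subalgebra.toSubmodule A

/-- The support of a semistar operation on `D`: the elements `A` of the skeleton
such that `A^⋆` is a fractional ideal of `A`. -/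
def supp (s : Semistar D K) : Set (Subalgebra D K) :=
  {A | A ∈ SkOver D K ∧ IsFracOf D K A (s.toFun (Subalgebra.toSubmodule A))}

/-- The image of an ideal of `D` inside `K`. -/
def idealToK (P : Ideal D) : Submodule D K := Submodule.map (Algebra.linearMap D K) P

end Paper

namespace Paper

/-- An abstract fractional star operation on a commutative ring `A`, acting on
the fractional ideals of `A` inside its fraction ring. -/
structure AFracStar (A : Type*) [CommRing A] where
  toFun : FractionalIdeal (nonZeroDivisors A) (FractionRing A) →
    FractionalIdeal (nonZeroDivisors A) (FractionRing A)
  le_star' : ∀ I, I ≤ toFun I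
  mono' : ∀ ⦃I J⦄, I ≤ J → toFun I ≤ toFun J
  idem' : ∀ I, toFun (toFun I) = toFun I
  smul' : ∀ (x : FractionRing A), x ≠ 0 → ∀ I,
    toFun (FractionalIdeal.spanSingleton (nonZeroDivisors A) x * I) =
      FractionalIdeal.spanSingleton (nonZeroDivisors A) x * toFun I

namespace AFracStar

variable {A : Type*} [CommRing A]

theorem ext' {s t : AFracStar A} (h : s.toFun = t.toFun) : s = t := by
  cases s; cases t; cases h; rfl

instance : PartialOrder (AFracStar A) where
  le s t := ∀ I, s.toFun I ≤ t.toFun I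
  le_refl _ _ := le_rfl
  le_trans _ _ _ hab hbc I := (hab I).trans (hbc I)
  le_antisymm _ _ h h' := ext' (funext fun I => le_antisymm (h I) (h' I))

end AFracStar

/-- Abstract star operations on `A`: fractional star operations closing `A`. -/
def AStar (A : Type*) [CommRing A] : Type _ := {s : AFracStar A // s.toFun 1 = 1}

instance (A : Type*) [CommRing A] : PartialOrder (AStar A) :=
  inferInstanceAs (PartialOrder {s : AFracStar A // s.toFun 1 = 1})

end Paper

namespace Paper

variable (D : Type*) [CommRing D] [IsDomain D]

/-- `P` is a branching point of `Spec(D)`: the infimum (among the primes) of a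
family of pairwise incomparable primes not containing `P`. -/
def IsBranchPoint (P : Ideal D) : Prop :=
  ∃ S : Set (Ideal D), (∀ Q ∈ S, Q.IsPrime) ∧
    (S.Pairwise fun Q₁ Q₂ => ¬Q₁ ≤ Q₂ ∧ ¬Q₂ ≤ Q₁) ∧ P ∉ S ∧
    (∀ Q ∈ S, P ≤ Q) ∧ ∀ P' : Ideal D, P'.IsPrime → (∀ Q ∈ S, P' ≤ Q) → P' ≤ P

/-- The homeomorphically irreducible tree underlying `Spec(D)`: the zero ideal,
the maximal ideals and the branching points, ordered by inclusion. -/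
def hiSpec : Set (Ideal D) :=
  {P | P.IsPrime ∧ (P = ⊥ ∨ P.IsMaximal ∨ IsBranchPoint D P)}

/-- `Q` is the element of `hiSpec D` directly below `P`. -/
def DirectlyBelow (Q P : Ideal D) : Prop :=
  Q ∈ hiSpec D ∧ P ∈ hiSpec D ∧ Q < P ∧ ∀ R ∈ hiSpec D, Q < R → ¬R < P

/-- The localization of `D` at the prime ideal `P`, as an abstract ring. -/
abbrev locRing (P : Ideal D) (hP : P.IsPrime) : Type _ :=
  Localization (@Ideal.primeCompl D _ P hP)

/-- The valuation ring `Z(P) = D_P / Q·D_P`. -/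
abbrev Zring (P Q : Ideal D) (hP : P.IsPrime) : Type _ :=
  locRing D P hP ⧸ Ideal.map (algebraMap D (locRing D P hP)) Q

/-- `ω(P) = |FStar(Z(P))|`, where `Q` is the element of `hiSpec D` directly
below `P`. -/
def omegaAt (P Q : Ideal D) (hP : P.IsPrime) : ℕ :=
  Nat.card (AFracStar (Zring D P Q hP))

open Classical in
/-- `ε(P) = |Star(D_P)| ∈ {1,2}` for a (nonzero) prime `P`. -/
def epsilonOf (A : Ideal D) : ℕ :=
  if h : A.IsPrime then Nat.card (AStar (locRing D A h)) else 0

end Paper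

namespace Paper

theorem mem_hiSpec_prime {D : Type*} [CommRing D] [IsDomain D] {P : Ideal D}
    (h : P ∈ hiSpec D) : P.IsPrime := h.1

theorem maximal_mem_hiSpec {D : Type*} [CommRing D] [IsDomain D] {M : Ideal D}
    (h : M.IsMaximal) : M ∈ hiSpec D := ⟨h.isPrime, Or.inr (Or.inl h)⟩

end Paper

namespace Paper

universe u v

/-- `x` is a minimal element of `𝒫 \ {⊥}`. -/
def IsMinNR {P : Type*} [PartialOrder P] [OrderBot P] (x : P) : Prop :=
  x ≠ ⊥ ∧ ∀ y : P, y ≠ ⊥ → y ≤ x → y = x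

section EquivariantClosure

/-- Closure operators on `L` commuting with all the self-maps `act g`. -/
abbrev EqClo {M L : Type*} [PartialOrder L] (act : M → L → L) :=
  {c : L → L // (∀ x, x ≤ c x) ∧ Monotone c ∧ (∀ x, c (c x) = c x) ∧
    ∀ g x, c (act g x) = act g (c x)}

namespace EqClo

variable {M L : Type*} [PartialOrder L] {act : M → L → L}

theorem le_iff {c d : EqClo act} : c ≤ d ↔ ∀ x, c.1 x ≤ d.1 x := Iff.rfl

theorem ext_fun {c d : EqClo act} (h : ∀ x, c.1 x = d.1 x) : c = d :=
  Subtype.ext (funext h)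

theorem top_apply [OrderTop L] [OrderTop (EqClo act)] (htop : ∀ g, act g ⊤ = ⊤) (x : L) :
    (⊤ : EqClo act).1 x = ⊤ := by
  let t : EqClo act :=
    ⟨fun _ => ⊤, fun _ => le_top, fun _ _ _ => le_rfl, fun _ => rfl, fun g _ => (htop g).symm⟩
  exact top_le_iff.1 ((le_top : t ≤ ⊤) x)

theorem apply_top [OrderTop L] (c : EqClo act) : c.1 ⊤ = ⊤ := top_le_iff.1 (c.2.1 ⊤)

theorem eq_top_of_apply_eq_top [OrderTop L] [OrderTop (EqClo act)] (htop : ∀ g, act g ⊤ = ⊤)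
    (hdir : ∀ x y : L, y ≠ ⊤ → ∃ g, act g y ≤ x) (c : EqClo act) {y : L} (hy : y ≠ ⊤)
    (h : c.1 y = ⊤) : c = ⊤ := by
  refine ext_fun fun x => ?_
  obtain ⟨g, hg⟩ := hdir x y hy
  have := c.2.2.1 hg
  rw [c.2.2.2.2, h, htop] at this
  rw [top_apply htop, top_le_iff.1 this]

/-- Equivariant closure operators transport along an isomorphism of posets with operators. -/
def congr {M' L' : Type*} [PartialOrder L'] {act' : M' → L' → L'} (e : L ≃o L')
    (h₁ : ∀ g, ∃ g', ∀ x, act' g' (e x) = e (act g x))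
    (h₂ : ∀ g', ∃ g, ∀ x, act' g' (e x) = e (act g x)) : EqClo act ≃o EqClo act' where
  toFun c := ⟨fun y => e (c.1 (e.symm y)),
    fun y => by rw [← e.symm_apply_le]; exact c.2.1 _,
    fun y z hyz => e.monotone (c.2.2.1 (e.symm.monotone hyz)),
    fun y => by simp [c.2.2.2.1],
    fun g' y => by
      obtain ⟨g, hg⟩ := h₂ g'
      beta_reduce
      rw [hg, ← c.2.2.2.2]
      congr 2
      refine congrArg c.1 ?_
      rw [e.symm_apply_eq, ← hg, e.apply_symm_apply]⟩
  invFun c := ⟨fun y => e.symm (c.1 (e y)),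
    fun y => by rw [e.le_symm_apply]; exact c.2.1 _,
    fun y z hyz => e.symm.monotone (c.2.2.1 (e.monotone hyz)),
    fun y => by simp [c.2.2.2.1],
    fun g y => by
      obtain ⟨g', hg⟩ := h₁ g
      beta_reduce
      rw [← hg, c.2.2.2.2, e.symm_apply_eq, ← hg, e.apply_symm_apply]⟩
  left_inv c := by ext; simp
  right_inv c := by ext; simp
  map_rel_iff' {c d} := by
    constructor
    · intro h x
      have := h (e x)
      simpa using this
    · intro h y
      exact e.monotone (h _)

end EqClo

/-- The poset of families of operators, indexed by subsets of `ι`, that describes equivariant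
closure operators on a product. -/
def Str {ι : Type*} (E : ι → Type*) [∀ i, PartialOrder (E i)] [∀ i, OrderTop (E i)] :=
  {f : Set ι → ∀ i, E i // (∀ S i, i ∉ S → f S i = ⊤) ∧ Antitone f ∧
    ∀ S, f {i | f S i ≠ ⊤} = f S}

instance {ι : Type*} (E : ι → Type*) [∀ i, PartialOrder (E i)] [∀ i, OrderTop (E i)] :
    PartialOrder (Str E) :=
  inferInstanceAs (PartialOrder {f : Set ι → ∀ i, E i // (∀ S i, i ∉ S → f S i = ⊤) ∧
    Antitone f ∧ ∀ S, f {i | f S i ≠ ⊤} = f S})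

instance {ι : Type*} [Finite ι] (E : ι → Type*) [∀ i, PartialOrder (E i)]
    [∀ i, OrderTop (E i)] [∀ i, Finite (E i)] : Finite (Str E) :=
  inferInstanceAs (Finite {f : Set ι → ∀ i, E i // (∀ S i, i ∉ S → f S i = ⊤) ∧
    Antitone f ∧ ∀ S, f {i | f S i ≠ ⊤} = f S})

namespace Str

variable {ι : Type*} {E E' : ι → Type*} [∀ i, PartialOrder (E i)] [∀ i, OrderTop (E i)]
  [∀ i, PartialOrder (E' i)] [∀ i, OrderTop (E' i)]

/-- The defining conditions of `Str` are invariant under order embeddings preserving `⊤`. -/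
theorem embedding_iff (ψ : ∀ i, E i ↪o E' i) (hψ : ∀ i, ψ i ⊤ = ⊤) (f : Set ι → ∀ i, E i) :
    ((∀ S i, i ∉ S → ψ i (f S i) = ⊤) ∧ Antitone (fun S i => ψ i (f S i)) ∧
      ∀ S, (fun i => ψ i (f {i | ψ i (f S i) ≠ ⊤} i)) = fun i => ψ i (f S i)) ↔
    ((∀ S i, i ∉ S → f S i = ⊤) ∧ Antitone f ∧ ∀ S, f {i | f S i ≠ ⊤} = f S) := by
  have key : ∀ i x, ψ i x = ⊤ ↔ x = ⊤ := fun i x => by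
    rw [← hψ i, (ψ i).injective.eq_iff]
  simp only [key, Antitone, Pi.le_def, (ψ _).le_iff_le, funext_iff, (ψ _).injective.eq_iff, ne_eq]

/-- `Str` respects order isomorphisms. -/
def congr (e : ∀ i, E i ≃o E' i) : Str E ≃o Str E' where
  toFun f := ⟨fun S i => e i (f.1 S i),
    (embedding_iff (fun i => (e i).toOrderEmbedding) (fun i => (e i).map_top) f.1).2 f.2⟩
  invFun f := ⟨fun S i => (e i).symm (f.1 S i),
    (embedding_iff (fun i => (e i).symm.toOrderEmbedding) (fun i => (e i).symm.map_top) f.1).2 f.2⟩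
  left_inv f := Subtype.ext (by funext S i; simp)
  right_inv f := Subtype.ext (by funext S i; simp)
  map_rel_iff' {f g} := by
    constructor
    · intro h S i
      exact (e i).le_iff_le.1 (h S i)
    · intro h S i
      exact (e i).le_iff_le.2 (h S i)

end Str

section Product

variable {ι M : Type*} {L : ι → Type*} [∀ i, PartialOrder (L i)] [∀ i, OrderTop (L i)]
  (act : ∀ i, M → L i → L i)

/-- The operators act diagonally on a product. -/
abbrev piAct (g : M) (x : ∀ i, L i) : ∀ i, L i := fun i => act i g (x i)

open Classical in
/-- The tuple which is `w` on `S` and `⊤` elsewhere. -/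
def baseTuple (w : ∀ i, L i) (S : Set ι) : ∀ i, L i := fun i => if i ∈ S then w i else ⊤

variable {act}

open Classical in
theorem EqClo.apply_update_le
    (hone : ∃ g, ∀ i x, act i g x = x) (happ : ∀ g : ι → M, ∃ h, ∀ i x, act i h x = act i (g i) x)
    (hdir : ∀ i (x y : L i), y ≠ ⊤ → ∃ g, act i g y ≤ x)
    (c : EqClo (piAct act)) (x y : ∀ i, L i) (i : ι) (hi : x i = y i)
    (hxy : ∀ j, x j = ⊤ → y j = ⊤) : c.1 x i ≤ c.1 y i := by
  obtain ⟨g₁, hg₁⟩ := hone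
  have : ∀ j, ∃ g, (j = i → g = g₁) ∧ act j g (x j) ≤ y j := by
    intro j
    by_cases hj : j = i
    · subst hj
      exact ⟨g₁, fun _ => rfl, by rw [hg₁, hi]⟩
    · by_cases hx : x j = ⊤
      · exact ⟨g₁, fun _ => rfl, by rw [hxy j hx]; exact le_top⟩
      · obtain ⟨g, hg⟩ := hdir j (y j) (x j) hx
        exact ⟨g, fun h => absurd h hj, hg⟩
  choose g hg hgle using this
  obtain ⟨h, hh⟩ := happ g
  have h1 : piAct act h x ≤ y := fun j => by
    change act j h (x j) ≤ y j
    rw [hh]; exact hgle j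
  have h2 := c.2.2.1 h1 i
  rw [c.2.2.2.2] at h2
  change act i h _ ≤ _ at h2
  rwa [hh, hg i rfl, hg₁] at h2

open Classical in
/-- Equivariant closure operators on a product of posets on which the operators act
independently, transitively enough, are described by `Str`. -/
theorem EqClo.nonempty_pi_orderIso [∀ i, OrderTop (EqClo (act i))]
    (htop : ∀ i g, act i g ⊤ = ⊤) (hinj : ∀ i g, Function.Injective (act i g))
    (hone : ∃ g, ∀ i x, act i g x = x) (happ : ∀ g : ι → M, ∃ h, ∀ i x, act i h x = act i (g i) x)
    (hdir : ∀ i (x y : L i), y ≠ ⊤ → ∃ g, act i g y ≤ x)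
    (w : ∀ i, L i) (hw : ∀ i, w i ≠ ⊤) :
    Nonempty (EqClo (piAct act) ≃o Str (fun i => EqClo (act i))) := by
  have hactTop : ∀ i g (x : L i), act i g x = ⊤ ↔ x = ⊤ := fun i g x =>
    ⟨fun h => hinj i g (h.trans (htop i g).symm), fun h => by rw [h, htop]⟩
  have hbase : ∀ S j, baseTuple w S j = ⊤ ↔ j ∉ S := fun S j => by
    by_cases h : j ∈ S <;> simp [baseTuple, h, hw]
  have htopapp : ∀ i (x : L i), (⊤ : EqClo (act i)).1 x = ⊤ := fun i => top_apply (htop i)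
  have hne : ∀ i (e : EqClo (act i)) (x : L i), e ≠ ⊤ → x ≠ ⊤ → e.1 x ≠ ⊤ :=
    fun i e x he hx h => he (eq_top_of_apply_eq_top (htop i) (hdir i) e hx h)
  -- from families of operators to operators on the product
  let toPi (f : Str fun i => EqClo (act i)) : EqClo (piAct act) :=
    ⟨fun x i => (f.1 {j | x j ≠ ⊤} i).1 (x i), by
      refine ⟨fun x i => (f.1 _ i).2.1 _, ?_, ?_, ?_⟩
      · intro x y hxy i
        have : f.1 {j | x j ≠ ⊤} ≤ f.1 {j | y j ≠ ⊤} := f.2.2.1 fun j hj hx =>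
          hj (top_le_iff.1 (hx ▸ hxy j))
        exact (this i _).trans ((f.1 _ i).2.2.1 (hxy i))
      · intro x
        funext i
        have : {j | (f.1 {j | x j ≠ ⊤} j).1 (x j) ≠ ⊤} = {j | f.1 {j | x j ≠ ⊤} j ≠ ⊤} := by
          ext j
          refine ⟨fun h h' => h (by rw [h', htopapp]), fun h => hne j _ _ h fun hx => h ?_⟩
          exact f.2.1 _ _ (by simpa using hx)
        simp only
        rw [this, f.2.2.2, (f.1 _ i).2.2.2.1]
      · intro g x
        funext i
        have : {j | piAct act g x j ≠ ⊤} = {j | x j ≠ ⊤} := by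
          ext j; simp [hactTop]
        simp only
        rw [this, (f.1 _ i).2.2.2.2]⟩
  have hle : ∀ f f' : Str fun i => EqClo (act i), toPi f ≤ toPi f' ↔ f ≤ f' := by
    intro f f'
    constructor
    · intro h S i y
      by_cases hy : y = ⊤
      · rw [hy, apply_top, apply_top]
      by_cases hi : i ∈ S
      · have := h (Function.update (baseTuple w S) i y) i
        have hS : {j | Function.update (baseTuple w S) i y j ≠ ⊤} = S := by
          ext j
          by_cases hj : j = i
          · subst hj; simp [hy, hi]
          · simp [hj, hbase]
        simp only [toPi] at this
        rw [hS] at this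
        simpa using this
      · rw [f.2.1 S i hi, f'.2.1 S i hi]
    · intro h x i
      exact h _ _ _
  let emb : (Str fun i => EqClo (act i)) ↪o EqClo (piAct act) :=
    OrderEmbedding.ofMapLEIff toPi hle
  have hsurj : Function.Surjective toPi := by
    intro c
    have hind : ∀ (x y : ∀ i, L i) (i : ι), x i = y i → (∀ j, x j = ⊤ ↔ y j = ⊤) →
        c.1 x i = c.1 y i := fun x y i hi hxy =>
      le_antisymm (c.apply_update_le hone happ hdir x y i hi fun j => (hxy j).1)
        (c.apply_update_le hone happ hdir y x i hi.symm fun j => (hxy j).2)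
    let F (S : Set ι) (i : ι) : EqClo (act i) :=
      if hi : i ∈ S then
        ⟨fun y => c.1 (Function.update (baseTuple w S) i y) i, by
          refine ⟨fun y => ?_, fun y z hyz => ?_, fun y => ?_, fun g y => ?_⟩
          · simpa using c.2.1 (Function.update (baseTuple w S) i y) i
          · exact c.2.2.1 (update_le_update_iff.2 ⟨hyz, fun _ _ => le_rfl⟩) i
          · refine le_antisymm ?_ (by
              simpa using c.2.1 (Function.update (baseTuple w S) i _) i)
            have : Function.update (baseTuple w S) i
                (c.1 (Function.update (baseTuple w S) i y) i) ≤
                c.1 (Function.update (baseTuple w S) i y) := by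
              intro j
              by_cases hj : j = i
              · subst hj; simp
              · simpa [hj] using c.2.1 (Function.update (baseTuple w S) i y) j
            have := c.2.2.1 this i
            rwa [c.2.2.2.1] at this
          · obtain ⟨g₁, hg₁⟩ := hone
            obtain ⟨h, hh⟩ := happ (Function.update (fun _ => g₁) i g)
            have : Function.update (baseTuple w S) i (act i g y) =
                piAct act h (Function.update (baseTuple w S) i y) := by
              funext j
              simp only [piAct, hh]
              by_cases hj : j = i
              · subst hj; simp
              · simp [hj, hg₁]
            simp only
            rw [this, c.2.2.2.2]
            simp [piAct, hh]⟩
      else ⊤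
    have hF : ∀ S i (hi : i ∈ S) y,
        (F S i).1 y = c.1 (Function.update (baseTuple w S) i y) i := by
      intro S i hi y
      simp only [F, dif_pos hi]
    have hF' : ∀ S i, i ∉ S → F S i = ⊤ := fun S i hi => by simp only [F, dif_neg hi]
    have hcF : ∀ (x : ∀ i, L i) i, x i ≠ ⊤ → (F {j | x j ≠ ⊤} i).1 (x i) = c.1 x i := by
      intro x i hi
      rw [hF _ _ (by exact hi)]
      refine hind _ _ _ (by simp) fun j => ?_
      by_cases hj : j = i
      · subst hj; simp
      · simp [hj, hbase]
    have hanti : Antitone F := by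
      intro S S' hSS' i y
      by_cases hi : i ∈ S
      · rw [hF S i hi, hF S' i (hSS' hi)]
        refine c.2.2.1 ?_ i
        intro j
        by_cases hj : j = i
        · subst hj; simp
        · by_cases hjS : j ∈ S
          · simp [hj, baseTuple, hjS, hSS' hjS]
          · simp [hj, baseTuple, hjS]
      · rw [hF' S i hi, htopapp]; exact le_top
    refine ⟨⟨F, hF', hanti, fun S => funext fun i => ?_⟩, ?_⟩
    · by_cases hi : F S i = ⊤
      · rw [hi]; exact hF' _ _ (by simp [hi])
      have hiS : i ∈ S := by
        by_contra h
        exact hi (hF' S i h)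
      have hsub : {j | F S j ≠ ⊤} ⊆ S := fun j hj => by
        by_contra h
        exact hj (hF' S j h)
      refine le_antisymm (fun y => ?_) (hanti hsub i)
      by_cases hy : y = ⊤
      · rw [hy, apply_top, apply_top]
      rw [hF S i hiS, hF _ i (by exact hi)]
      set x := Function.update (baseTuple w S) i y with hx
      have hxS : {j | x j ≠ ⊤} = S := by
        ext j
        by_cases hj : j = i
        · subst hj; simp [hx, hy, hiS]
        · simp [hx, hj, hbase]
      have hle' : Function.update (baseTuple w {j | F S j ≠ ⊤}) i y ≤ c.1 x := by
        intro j
        by_cases hj : j = i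
        · subst hj
          have := c.2.1 x j
          simpa [hx] using this
        · by_cases hjF : F S j = ⊤
          · have : c.1 x j = ⊤ := by
              by_cases hxj : x j = ⊤
              · exact top_le_iff.1 (hxj ▸ c.2.1 x j)
              · rw [← hcF x j hxj, hxS, hjF, htopapp]
            rw [this]; exact le_top
          · have hjS : j ∈ S := hsub hjF
            have : Function.update (baseTuple w {j | F S j ≠ ⊤}) i y j = x j := by
              simp [hx, hj, baseTuple, hjF, hjS]
            rw [this]
            exact c.2.1 x j
      have := c.2.2.1 hle' i
      rwa [c.2.2.2.1] at this
    · refine ext_fun fun x => funext fun i => ?_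
      change (F {j | x j ≠ ⊤} i).1 (x i) = c.1 x i
      by_cases hi : x i = ⊤
      · rw [hi, apply_top]
        exact (top_le_iff.1 (hi ▸ c.2.1 x i)).symm
      · exact hcF x i hi
  exact ⟨(RelIso.ofSurjective emb hsurj).symm⟩

end Product

end EquivariantClosure

section Counting

/-- Extend an order embedding on the upper summand by the identity on the lower one. -/
def lexEmb (C : Type*) [PartialOrder C] {α β : Type*} [PartialOrder α] [PartialOrder β]
    (φ : α ↪o β) : (C ⊕ₗ α) ↪o (C ⊕ₗ β) :=
  OrderEmbedding.ofMapLEIff (fun x => toLex (Sum.map id φ (ofLex x))) fun x y => by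
    rcases x with x | x <;> rcases y with y | y
    · change toLex (Sum.inl _) ≤ toLex (Sum.inl _) ↔ toLex (Sum.inl _) ≤ toLex (Sum.inl _)
      simp
    · change toLex (Sum.inl _) ≤ toLex (Sum.inr _) ↔ toLex (Sum.inl _) ≤ toLex (Sum.inr _)
      simp
    · change toLex (Sum.inr _) ≤ toLex (Sum.inl _) ↔ toLex (Sum.inr _) ≤ toLex (Sum.inl _)
      simp
    · change toLex (Sum.inr _) ≤ toLex (Sum.inr _) ↔ toLex (Sum.inr _) ≤ toLex (Sum.inr _)
      simp

/-- The operator poset with variable chain part of length `n`. -/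
abbrev WT (C : Type*) (n : ℕ) := WithTop (C ⊕ₗ Fin n)

/-- The `j`-th element of the chain part. -/
def WT.ofFin {C : Type*} {n : ℕ} (j : Fin n) : WT C n := ((toLex (Sum.inr j) : C ⊕ₗ Fin n) : WithTop _)

theorem WT.ofFin_injective {C : Type*} {n : ℕ} :
    Function.Injective (WT.ofFin (C := C) (n := n)) := fun i j h => by
  have := WithTop.coe_injective h
  exact Sum.inr_injective (toLex.injective this)

/-- The embedding of operator posets induced by an embedding of chains. -/
def WT.emb (C : Type*) [PartialOrder C] {m n : ℕ} (φ : Fin m ↪o Fin n) : WT C m ↪o WT C n :=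
  (lexEmb C φ).withTopMap

theorem WT.mem_range_emb {C : Type*} [PartialOrder C] {m n : ℕ} (φ : Fin m ↪o Fin n) (x : WT C n)
    (h : ∀ j, x = WT.ofFin j → j ∈ Set.range φ) : ∃ y, WT.emb C φ y = x := by
  induction x using WithTop.recTopCoe with
  | top => exact ⟨⊤, rfl⟩
  | coe x =>
    rcases x with x | x
    · exact ⟨((toLex (Sum.inl x) : C ⊕ₗ Fin m) : WithTop _), rfl⟩
    · obtain ⟨i, rfl⟩ := h x rfl
      exact ⟨WT.ofFin i, rfl⟩

variable {ι : Type*} (C : ι → Type*) [∀ i, PartialOrder (C i)]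

/-- The elements of the chain part that are values of a member of `Str`. -/
def usedSet {n : ι → ℕ} (f : Str fun i => WT (C i) (n i)) (i : ι) : Set (Fin (n i)) :=
  {j | ∃ S, f.1 S i = WT.ofFin j}

/-- Members of `Str` taking all values in the chain parts. -/
abbrev SurjStr (m : ι → ℕ) :=
  {f : Str fun i => WT (C i) (m i) // ∀ i, usedSet C f i = Set.univ}

theorem card_used_eq {n : ι → ℕ} (A : ∀ i, Finset (Fin (n i))) :
    Nat.card {f : Str fun i => WT (C i) (n i) // ∀ i, usedSet C f i = A i} =
      Nat.card (SurjStr C fun i => (A i).card) := by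
  let φ (i : ι) : Fin (A i).card ↪o Fin (n i) := (A i).orderEmbOfFin rfl
  have hφ : ∀ i, Set.range (φ i) = A i := fun i => Finset.range_orderEmbOfFin _ _
  let ψ (i : ι) := WT.emb (C i) (φ i)
  have hψ : ∀ i, ψ i ⊤ = ⊤ := fun i => rfl
  let F (f : Str fun i => WT (C i) (A i).card) : Str fun i => WT (C i) (n i) :=
    ⟨fun S i => ψ i (f.1 S i), (Str.embedding_iff ψ hψ f.1).2 f.2⟩
  have hF : ∀ f i, usedSet C (F f) i = φ i '' usedSet C f i := by
    intro f i
    ext j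
    constructor
    · rintro ⟨S, hS⟩
      change ψ i (f.1 S i) = _ at hS
      rcases hx : f.1 S i with _ | x
      · rw [hx] at hS; cases hS
      · rw [hx] at hS
        rcases x with x | x
        · exact nomatch (toLex.injective (WithTop.coe_injective hS) : Sum.inl x = Sum.inr j)
        · exact ⟨x, ⟨S, hx⟩, WT.ofFin_injective (C := C i) hS⟩
    · rintro ⟨j, ⟨S, hS⟩, rfl⟩
      exact ⟨S, by change ψ i (f.1 S i) = _; rw [hS]; rfl⟩
  refine (Nat.card_eq_of_bijective (fun f : SurjStr C fun i => (A i).card =>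
    (⟨F f.1, fun i => by rw [hF, f.2 i, Set.image_univ, hφ]⟩ :
      {f : Str fun i => WT (C i) (n i) // ∀ i, usedSet C f i = A i})) ⟨?_, ?_⟩).symm
  · intro f g hfg
    refine Subtype.ext (Subtype.ext (funext fun S => funext fun i => (ψ i).injective ?_))
    exact congrFun (congrFun (congrArg (fun x => x.1.1) hfg) S) i
  · rintro ⟨f, hf⟩
    have : ∀ S i, ∃ y, ψ i y = f.1 S i := fun S i =>
      WT.mem_range_emb _ _ fun j hj => by
        rw [hφ, ← hf]
        exact ⟨S, hj⟩
    choose g hg using this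
    have hfg : f.1 = fun S i => ψ i (g S i) := funext fun S => funext fun i => (hg S i).symm
    let g' : Str fun i => WT (C i) (A i).card :=
      ⟨g, (Str.embedding_iff ψ hψ g).1 (by have := f.2; rw [hfg] at this; exact this)⟩
    have hFg : F g' = f := Subtype.ext hfg.symm
    refine ⟨⟨g', fun i => ?_⟩, Subtype.ext hFg⟩
    have := hF g' i
    rw [hFg, hf, ← hφ, ← Set.image_univ] at this
    exact ((φ i).injective.image_injective this).symm

variable [Fintype ι] [DecidableEq ι]

theorem card_set_mem (i : ι) : Nat.card {S : Set ι // i ∈ S} = 2 ^ (Nat.card ι - 1) := by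
  have e : {S : Set ι // i ∈ S} ≃ Set {j : ι // j ≠ i} :=
    { toFun := fun S => {j | j.1 ∈ S.1}
      invFun := fun T => ⟨{j | ∀ h : j ≠ i, (⟨j, h⟩ : {j : ι // j ≠ i}) ∈ T}, fun h => absurd rfl h⟩
      left_inv := fun S => by
        ext j
        by_cases hj : j = i
        · subst hj; simp [S.2]
        · simp [hj]
      right_inv := fun T => by
        ext j
        simp [j.2] }
  rw [Nat.card_congr e, Nat.card_eq_fintype_card, Fintype.card_set, Fintype.card_subtype_compl,
    Nat.card_eq_fintype_card, Fintype.card_subtype_eq]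

theorem surjStr_le {m : ι → ℕ} (f : SurjStr C m) (i : ι) : m i ≤ 2 ^ (Nat.card ι - 1) := by
  have h : ∀ j : Fin (m i), ∃ S : {S : Set ι // i ∈ S}, f.1.1 S.1 i = WT.ofFin j := by
    intro j
    obtain ⟨S, hS⟩ : j ∈ usedSet C f.1 i := by rw [f.2]; trivial
    refine ⟨⟨S, ?_⟩, hS⟩
    by_contra hi
    rw [f.1.2.1 S i hi] at hS
    exact absurd hS (by simp [WT.ofFin])
  choose S hS using h
  have : Function.Injective S := fun j k hjk => WT.ofFin_injective (C := C i) (by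
    rw [← hS j, ← hS k, hjk])
  have := Nat.card_le_card_of_injective S this
  rwa [card_set_mem, Nat.card_eq_fintype_card, Fintype.card_fin] at this

open Classical in
theorem surjStr_nonempty : Nonempty (SurjStr C fun _ => 2 ^ (Nat.card ι - 1)) := by
  have h : ∀ i : ι, ∃ ℓ : {S : Set ι // i ∈ S} → Fin (2 ^ (Nat.card ι - 1)),
      Antitone ℓ ∧ Function.Surjective ℓ := by
    intro i
    let α := LinearExtension ({S : Set ι // i ∈ S}ᵒᵈ)
    have hα : Finite α := inferInstanceAs (Finite {S : Set ι // i ∈ S})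
    have := Fintype.ofFinite α
    have hc : Fintype.card α = 2 ^ (Nat.card ι - 1) := by
      rw [← card_set_mem i, ← Nat.card_eq_fintype_card]
      rfl
    let e := monoEquivOfFin α hc
    refine ⟨fun S => e.symm (toLinearExtension (OrderDual.toDual S)), ?_, ?_⟩
    · intro S T hST
      exact e.symm.monotone (toLinearExtension.monotone (OrderDual.toDual_le_toDual.2 hST))
    · intro j
      exact ⟨(e j : {S : Set ι // i ∈ S}), e.symm_apply_apply j⟩
  choose ℓ hℓ hsurj using h
  let f (S : Set ι) (i : ι) : WT (C i) (2 ^ (Nat.card ι - 1)) :=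
    if h : i ∈ S then WT.ofFin (ℓ i ⟨S, h⟩) else ⊤
  have hf : ∀ S, {i | f S i ≠ ⊤} = S := fun S => by
    ext i
    by_cases h : i ∈ S <;> simp [f, h, WT.ofFin]
  refine ⟨⟨⟨f, fun S i h => by simp [f, h], fun S T hST i => ?_, fun S => by rw [hf]⟩, fun i => ?_⟩⟩
  · by_cases h : i ∈ S
    · have h' := hST h
      simp only [f, dif_pos h, dif_pos h', WT.ofFin, WithTop.coe_le_coe, Sum.Lex.inr_le_inr_iff]
      exact hℓ i hST
    · simp [f, h]
  · refine Set.eq_univ_of_forall fun j => ?_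
    obtain ⟨S, rfl⟩ := hsurj i j
    exact ⟨S.1, by simp [f, S.2]⟩

theorem card_str_eq_sum [∀ i, Finite (C i)] (n : ι → ℕ) :
    Nat.card (Str fun i => WT (C i) (n i)) =
      ∑ m ∈ Fintype.piFinset fun _ : ι => Finset.range (2 ^ (Nat.card ι - 1) + 1),
        Nat.card (SurjStr C m) * ∏ i, (n i).choose (m i) := by
  classical
  let used (f : Str fun i => WT (C i) (n i)) (i : ι) : Finset (Fin (n i)) :=
    (usedSet C f i).toFinset
  have : ∀ i, Finite (WT (C i) (n i)) := fun i =>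
    inferInstanceAs (Finite (Option (C i ⊕ Fin (n i))))
  rw [← Nat.card_congr (Equiv.sigmaFiberEquiv used), Nat.card_sigma]
  have h1 : ∀ A : ∀ i, Finset (Fin (n i)), Nat.card {f // used f = A} =
      Nat.card (SurjStr C fun i => (A i).card) := by
    intro A
    rw [← card_used_eq]
    refine Nat.card_congr (Equiv.subtypeEquivRight fun f => ?_)
    rw [funext_iff]
    refine forall_congr' fun i => ?_
    rw [← Finset.coe_inj]
    simp [used]
  simp_rw [h1]
  have h2 : ∀ A : ∀ i, Finset (Fin (n i)), Nat.card (SurjStr C fun i => (A i).card) =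
      ∑ m ∈ Fintype.piFinset fun _ : ι => Finset.range (2 ^ (Nat.card ι - 1) + 1),
        if (fun i => (A i).card) = m then Nat.card (SurjStr C m) else 0 := by
    intro A
    rw [Finset.sum_ite_eq]
    split_ifs with h
    · rfl
    · rw [Nat.card_eq_zero]
      left
      by_contra hne
      rw [not_isEmpty_iff] at hne
      obtain ⟨f⟩ := hne
      exact h (by
        rw [Fintype.mem_piFinset]
        exact fun i => Finset.mem_range.2 (Nat.lt_succ_of_le (surjStr_le C f i)))
  simp_rw [h2]
  rw [Finset.sum_comm]
  refine Finset.sum_congr rfl fun m _ => ?_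
  rw [← Finset.sum_filter, Finset.sum_const, smul_eq_mul, mul_comm]
  congr 1
  have : (Finset.univ.filter fun A : ∀ i, Finset (Fin (n i)) => (fun i => (A i).card) = m) =
      Fintype.piFinset fun i => Finset.powersetCard (m i) (Finset.univ : Finset (Fin (n i))) := by
    ext A
    simp [funext_iff, Finset.mem_powersetCard]
  rw [this, Fintype.card_piFinset]
  simp

end Counting

section ChoosePolynomial

open Polynomial

/-- The polynomial `binom (X - 1) m`. -/
def choosePoly (m : ℕ) : ℚ[X] := Polynomial.C ((m.factorial : ℚ)⁻¹) * (descPochhammer ℚ m).comp (X - 1)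

theorem choosePoly_eval (m n : ℕ) : (choosePoly m).eval ((n : ℚ) + 1) = n.choose m := by
  rw [choosePoly, eval_mul, eval_C, eval_comp, eval_sub, eval_X, eval_one, add_sub_cancel_right,
    descPochhammer_eval_eq_descFactorial, Nat.descFactorial_eq_factorial_mul_choose, Nat.cast_mul,
    inv_mul_cancel_left₀ (by exact_mod_cast m.factorial_ne_zero)]

theorem choosePoly_natDegree (m : ℕ) : (choosePoly m).natDegree = m := by
  rw [choosePoly, natDegree_C_mul (by simpa using m.factorial_ne_zero), natDegree_comp,
    descPochhammer_natDegree, ← C_1, natDegree_X_sub_C, mul_one]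

theorem choosePoly_ne_zero (m : ℕ) : choosePoly m ≠ 0 := by
  intro h
  have := choosePoly_eval m m
  rw [h] at this
  simp at this

theorem totalDegree_aeval_X_le {σ : Type*} (p : ℚ[X]) (i : σ) :
    (aeval (MvPolynomial.X i : MvPolynomial σ ℚ) p).totalDegree ≤ p.natDegree := by
  rw [aeval_eq_sum_range]
  refine MvPolynomial.totalDegree_finsetSum_le fun j hj => ?_
  refine (MvPolynomial.totalDegree_smul_le _ _).trans ((MvPolynomial.totalDegree_pow _ _).trans ?_)
  rw [MvPolynomial.totalDegree_X, mul_one]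
  exact Nat.lt_succ_iff.1 (Finset.mem_range.1 hj)

/-- The number of elements of `Str`, as a function of the lengths of the chain parts. -/
theorem exists_polynomial_card_str {ι : Type*} [Finite ι] (C : ι → Type*)
    [∀ i, PartialOrder (C i)] [∀ i, Finite (C i)] :
    ∃ π : MvPolynomial ι ℚ, π.totalDegree = Nat.card ι * 2 ^ (Nat.card ι - 1) ∧
      ∀ n : ι → ℕ, (Nat.card (Str fun i => WT (C i) (n i)) : ℚ) + 1 =
        MvPolynomial.eval (fun i => (n i : ℚ) + 1) π := by
  classical
  have := Fintype.ofFinite ι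
  set N := 2 ^ (Nat.card ι - 1) with hN
  let box := Fintype.piFinset fun _ : ι => Finset.range (N + 1)
  let π : MvPolynomial ι ℚ := 1 + ∑ m ∈ box, MvPolynomial.C (Nat.card (SurjStr C m) : ℚ) *
    ∏ i, aeval (MvPolynomial.X i : MvPolynomial ι ℚ) (choosePoly (m i))
  have hcard : ∑ _i : ι, N = Nat.card ι * N := by simp
  have hupper : π.totalDegree ≤ Nat.card ι * N := by
    refine (MvPolynomial.totalDegree_add _ _).trans (max_le (by simp) ?_)
    refine MvPolynomial.totalDegree_finsetSum_le fun m hm => ?_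
    refine (MvPolynomial.totalDegree_mul _ _).trans ?_
    rw [MvPolynomial.totalDegree_C, zero_add]
    refine (MvPolynomial.totalDegree_finsetProd _ _).trans ?_
    rw [← hcard]
    refine Finset.sum_le_sum fun i _ => (totalDegree_aeval_X_le _ _).trans ?_
    rw [choosePoly_natDegree]
    exact Nat.lt_succ_iff.1 (Finset.mem_range.1 (Fintype.mem_piFinset.1 hm i))
  refine ⟨π, le_antisymm hupper ?_, fun n => ?_⟩
  · by_cases h0 : Nat.card ι * N = 0
    · rw [h0]; exact Nat.zero_le _
    let φ : MvPolynomial ι ℚ →ₐ[ℚ] ℚ[X] := MvPolynomial.aeval fun _ => X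
    have hφ : φ π = 1 + ∑ m ∈ box, Polynomial.C (Nat.card (SurjStr C m) : ℚ) *
        ∏ i, choosePoly (m i) := by
      simp only [π, map_add, map_one, map_sum, map_mul, map_prod]
      congr 1
      refine Finset.sum_congr rfl fun m _ => ?_
      congr 1
      · exact MvPolynomial.aeval_C _ _
      · refine Finset.prod_congr rfl fun i _ => ?_
        rw [← aeval_algHom_apply, MvPolynomial.aeval_X, aeval_X_left_apply]
    have hdeg : (φ π).natDegree ≤ π.totalDegree * 1 :=
      MvPolynomial.aeval_natDegree_le π le_rfl _ fun i => natDegree_X_le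
    rw [mul_one] at hdeg
    refine le_trans (le_natDegree_of_ne_zero ?_) hdeg
    have hprod : ∀ m : ι → ℕ, (∏ i, choosePoly (m i)).natDegree = ∑ i, m i := fun m => by
      rw [natDegree_prod _ _ fun i _ => choosePoly_ne_zero _]
      simp [choosePoly_natDegree]
    rw [hφ, coeff_add, coeff_one, if_neg h0, zero_add, finsetSum_coeff,
      Finset.sum_eq_single (fun _ => N)]
    · rw [coeff_C_mul]
      refine mul_ne_zero ?_ ?_
      · have hE : ∀ i, Finite (WT (C i) N) := fun i =>
          inferInstanceAs (Finite (Option (C i ⊕ Fin N)))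
        have := surjStr_nonempty C
        exact_mod_cast Nat.card_pos.ne'
      · rw [← hcard, ← hprod, coeff_natDegree, Ne, leadingCoeff_eq_zero]
        exact Finset.prod_ne_zero_iff.2 fun i _ => choosePoly_ne_zero _
    · intro m hm hne
      rw [coeff_C_mul, coeff_eq_zero_of_natDegree_lt, mul_zero]
      rw [hprod, ← hcard]
      have hle : ∀ i, m i ≤ N := fun i =>
        Nat.lt_succ_iff.1 (Finset.mem_range.1 (Fintype.mem_piFinset.1 hm i))
      obtain ⟨i, hi⟩ := Function.ne_iff.1 hne
      exact Finset.sum_lt_sum (fun i _ => hle i) ⟨i, Finset.mem_univ i, lt_of_le_of_ne (hle i) hi⟩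
    · intro h
      exact absurd (Fintype.mem_piFinset.2 fun i => Finset.mem_range.2 (Nat.lt_succ_self N)) h
  · rw [card_str_eq_sum, add_comm]
    simp only [π, map_add, map_one, map_sum, map_mul, map_prod, MvPolynomial.eval_C,
      Nat.cast_sum, Nat.cast_mul, Nat.cast_prod]
    congr 1
    refine Finset.sum_congr rfl fun m _ => ?_
    congr 1
    refine Finset.prod_congr rfl fun i _ => ?_
    rw [← choosePoly_eval, ← MvPolynomial.coe_aeval_eq_eval, RingHom.coe_coe,
      ← aeval_algHom_apply, MvPolynomial.aeval_X, coe_aeval_eq_eval]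

end ChoosePolynomial

section Localizations

variable {D : Type*} [CommRing D] [IsDomain D]
variable (K : Type*) [Field K] [Algebra D K] [IsFractionRing D K]

/-- The localization of `D` at a prime, as a submodule of `K`. -/
def V (p : PrimeSpectrum D) : Submodule D K :=
  Subalgebra.toSubmodule (locAt D K p.asIdeal p.isPrime)

variable {K}

theorem mem_V {p : PrimeSpectrum D} {x : K} :
    x ∈ V K p ↔ ∃ s ∉ p.asIdeal, ∃ a : D, algebraMap D K s * x = algebraMap D K a := by
  have hle : p.asIdeal.primeCompl ≤ nonZeroDivisors D := fun _ hx =>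
    mem_nonZeroDivisors_of_ne_zero fun h => hx (h ▸ p.asIdeal.zero_mem)
  change (∃ (a s : D) (hs : s ∈ p.asIdeal.primeCompl), x = IsLocalization.mk' K a ⟨s, hle hs⟩) ↔ _
  simp_rw [IsLocalization.eq_mk'_iff_mul_eq]
  exact ⟨fun ⟨a, s, hs, h⟩ => ⟨s, hs, a, by rw [← h, mul_comm]⟩,
    fun ⟨s, hs, a, h⟩ => ⟨a, s, hs, by rw [← h, mul_comm]⟩⟩

theorem algebraMap_ne_zero {p : PrimeSpectrum D} {s : D} (hs : s ∉ p.asIdeal) :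
    algebraMap D K s ≠ 0 := by
  have : s ≠ 0 := fun h => hs (h ▸ p.asIdeal.zero_mem)
  simpa using this

variable (K) in
/-- The maximal ideal of the localization of `D` at a prime, as a submodule of `K`. -/
def m (p : PrimeSpectrum D) : Submodule D K where
  carrier := {x | ∃ s ∉ p.asIdeal, ∃ a ∈ p.asIdeal, algebraMap D K s * x = algebraMap D K a}
  zero_mem' := ⟨1, fun h => p.isPrime.ne_top ((Ideal.eq_top_iff_one _).2 h), 0,
    p.asIdeal.zero_mem, by simp⟩
  add_mem' := by
    rintro x y ⟨s, hs, a, ha, h⟩ ⟨t, ht, b, hb, h'⟩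
    refine ⟨s * t, fun h => (p.isPrime.mem_or_mem h).elim hs ht, a * t + b * s,
      add_mem (Ideal.mul_mem_right _ _ ha) (Ideal.mul_mem_right _ _ hb), ?_⟩
    simp only [map_add, map_mul, ← h, ← h']
    ring
  smul_mem' := by
    rintro d x ⟨s, hs, a, ha, h⟩
    refine ⟨s, hs, d * a, Ideal.mul_mem_left _ _ ha, ?_⟩
    rw [Algebra.smul_def, map_mul, ← h]
    ring

theorem mem_m {p : PrimeSpectrum D} {x : K} :
    x ∈ m K p ↔ ∃ s ∉ p.asIdeal, ∃ a ∈ p.asIdeal, algebraMap D K s * x = algebraMap D K a :=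
  Iff.rfl

variable {p q : PrimeSpectrum D} {x y z : K}

theorem one_mem_V : (1 : K) ∈ V K p := one_mem (locAt D K p.asIdeal p.isPrime)

theorem algebraMap_mem_V (d : D) : algebraMap D K d ∈ V K p :=
  Subalgebra.algebraMap_mem (locAt D K p.asIdeal p.isPrime) d

theorem mul_mem_V (hx : x ∈ V K p) (hy : y ∈ V K p) : x * y ∈ V K p :=
  (locAt D K p.asIdeal p.isPrime).mul_mem hx hy

theorem m_le_V : m K p ≤ V K p := by
  rintro x ⟨s, hs, a, -, h⟩
  exact mem_V.2 ⟨s, hs, a, h⟩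

theorem mul_mem_m (hx : x ∈ V K p) (hy : y ∈ m K p) : x * y ∈ m K p := by
  obtain ⟨s, hs, a, h⟩ := mem_V.1 hx
  obtain ⟨t, ht, b, hb, h'⟩ := hy
  refine ⟨s * t, fun h => (p.isPrime.mem_or_mem h).elim hs ht, a * b,
    Ideal.mul_mem_left _ _ hb, ?_⟩
  simp only [map_mul, ← h, ← h']
  ring

theorem algebraMap_mem_m {d : D} : algebraMap D K d ∈ m K p ↔ d ∈ p.asIdeal := by
  constructor
  · rintro ⟨s, hs, a, ha, h⟩
    rw [← map_mul] at h
    have h := IsFractionRing.injective D K h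
    exact (p.isPrime.mem_or_mem (h ▸ ha : s * d ∈ p.asIdeal)).resolve_left hs
  · exact fun h => ⟨1, fun h => p.isPrime.ne_top ((Ideal.eq_top_iff_one _).2 h), d, h, by simp⟩

theorem one_notMem_m : (1 : K) ∉ m K p := by
  rw [← map_one (algebraMap D K), algebraMap_mem_m]
  exact fun h => p.isPrime.ne_top ((Ideal.eq_top_iff_one _).2 h)

theorem V_anti (h : p ≤ q) : V K q ≤ V K p := by
  intro x hx
  obtain ⟨s, hs, a, h'⟩ := mem_V.1 hx
  exact mem_V.2 ⟨s, fun hh => hs (h hh), a, h'⟩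

theorem inv_mem_V (hx : x ∉ m K p) : x⁻¹ ∈ V K p ∨ x ∉ V K p := by
  by_cases h : x ∈ V K p
  · obtain ⟨s, hs, a, h'⟩ := mem_V.1 h
    refine Or.inl (mem_V.2 ⟨a, fun ha => hx ⟨s, hs, a, ha, h'⟩, s, ?_⟩)
    have : x ≠ 0 := fun h => hx (h ▸ zero_mem _)
    rw [← h']
    field_simp
  · exact Or.inr h

theorem ne_zero_of_notMem {J : Submodule D K} (hx : x ∉ J) : x ≠ 0 := fun h => hx (h ▸ zero_mem _)

theorem mem_V_or_inv [hP : Fact (IsPrufer D K)] (p : PrimeSpectrum D) (x : K) :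
    x ∈ V K p ∨ x⁻¹ ∈ V K p := by
  by_cases hx : x = 0
  · exact Or.inl (hx ▸ zero_mem _)
  obtain ⟨a, b, hb, rfl⟩ := IsFractionRing.div_surjective (A := D) x
  have hb0 : algebraMap D K b ≠ 0 := by simpa using nonZeroDivisors.ne_zero hb
  have ha0 : algebraMap D K a ≠ 0 := fun h => hx (by simp [h])
  obtain ⟨z, hz | hz⟩ := hP.out p.asIdeal p.isPrime
    ⟨algebraMap D K a, algebraMap_mem_V (p := p) a⟩ ⟨algebraMap D K b, algebraMap_mem_V (p := p) b⟩
  · have hz : algebraMap D K a * z = algebraMap D K b := congrArg Subtype.val hz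
    refine Or.inr ?_
    have hzV : (z : K) ∈ V K p := z.2
    convert! hzV using 1
    rw [← hz]; field_simp
  · have hz : algebraMap D K b * z = algebraMap D K a := congrArg Subtype.val hz
    refine Or.inl ?_
    have hzV : (z : K) ∈ V K p := z.2
    convert! hzV using 1
    rw [← hz]; field_simp

theorem m_inv_notMem_V (hx : x ∈ m K p) : x⁻¹ ∉ V K p ∨ x = 0 := by
  by_cases h : x = 0
  · exact Or.inr h
  · refine Or.inl fun h' => one_notMem_m (K := K) (p := p) ?_
    rw [← inv_mul_cancel₀ h]
    exact mul_mem_m h' hx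

variable [Fact (IsPrufer D K)]

theorem inv_mem_V_of_notMem_m (hx : x ∉ m K p) : x⁻¹ ∈ V K p :=
  (inv_mem_V hx).elim id fun h => (mem_V_or_inv p x).resolve_left h

theorem inv_mem_m (hx : x ∉ V K p) : x⁻¹ ∈ m K p := by
  by_contra h
  exact hx (inv_inv x ▸ inv_mem_V_of_notMem_m h)

theorem inv_notMem_m (h0 : x ≠ 0) (hx : x ∈ V K p) : x⁻¹ ∉ m K p := fun h =>
  (m_inv_notMem_V h).elim (fun h => h (by simpa using hx)) (fun h => h0 (by simpa using h))

theorem inv_notMem_V (h0 : x ≠ 0) (hx : x ∈ m K p) : x⁻¹ ∉ V K p :=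
  (m_inv_notMem_V hx).resolve_right h0

theorem mem_m_of_mul (hx : x ∉ m K p) (h : x * y ∈ m K p) : y ∈ m K p := by
  have := mul_mem_m (inv_mem_V_of_notMem_m hx) h
  rwa [inv_mul_cancel_left₀ (ne_zero_of_notMem hx)] at this

theorem mem_V_of_mul (hx : x ∉ m K p) (h : x * y ∈ V K p) : y ∈ V K p := by
  have := mul_mem_V (inv_mem_V_of_notMem_m hx) h
  rwa [inv_mul_cancel_left₀ (ne_zero_of_notMem hx)] at this

theorem m_mono (h : p ≤ q) : m K p ≤ m K q := by
  intro x hx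
  by_contra h'
  exact one_notMem_m (K := K) (p := p) <| by
    rw [← inv_mul_cancel₀ (ne_zero_of_notMem h')]
    exact mul_mem_m (V_anti h (inv_mem_V_of_notMem_m h')) hx

theorem m_le_V_of_le (h : p ≤ q) : m K p ≤ V K q := (m_mono h).trans m_le_V

theorem le_or_le_of_le (K : Type*) [Field K] [Algebra D K] [IsFractionRing D K]
    [Fact (IsPrufer D K)] {p' : PrimeSpectrum D} (h : p ≤ q) (h' : p' ≤ q) : p ≤ p' ∨ p' ≤ p := by
  by_contra! hc
  obtain ⟨a, ha, ha'⟩ := SetLike.not_le_iff_exists.1 (fun h => hc.1 h : ¬ p.asIdeal ≤ p'.asIdeal)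
  obtain ⟨b, hb, hb'⟩ := SetLike.not_le_iff_exists.1 (fun h => hc.2 h : ¬ p'.asIdeal ≤ p.asIdeal)
  have ha0 : algebraMap D K a ≠ 0 := algebraMap_ne_zero ha'
  have hb0 : algebraMap D K b ≠ 0 := algebraMap_ne_zero hb'
  rcases mem_V_or_inv q (algebraMap D K a / algebraMap D K b) with hx | hx
  · have := mul_mem_m (V_anti h' hx) (algebraMap_mem_m.2 hb)
    rw [div_mul_cancel₀ _ hb0, algebraMap_mem_m] at this
    exact ha' this
  · rw [inv_div] at hx
    have := mul_mem_m (V_anti h hx) (algebraMap_mem_m.2 ha)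
    rw [div_mul_cancel₀ _ ha0, algebraMap_mem_m] at this
    exact hb' this

end Localizations

section Modules

variable {D : Type*} [CommRing D] [IsDomain D]
variable (K : Type*) [Field K] [Algebra D K] [IsFractionRing D K]

variable {K}

theorem mem_smul_iff {x y : K} (hx : x ≠ 0) {J : Submodule D K} : y ∈ x • J ↔ x⁻¹ * y ∈ J := by
  rw [Submodule.mem_smul_pointwise_iff_exists]
  constructor
  · rintro ⟨z, hz, rfl⟩
    rwa [smul_eq_mul, inv_mul_cancel_left₀ hx]
  · exact fun h => ⟨_, h, by rw [smul_eq_mul, mul_inv_cancel_left₀ hx]⟩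

theorem mul_mem_smul {x y : K} {J : Submodule D K} (hy : y ∈ J) : x * y ∈ x • J :=
  Submodule.smul_mem_pointwise_smul y x J hy

theorem smul_le_smul_iff_of_ne {x : K} (hx : x ≠ 0) {J J' : Submodule D K} :
    x • J ≤ x • J' ↔ J ≤ J' :=
  ⟨fun h y hy => by
    have := h (mul_mem_smul (x := x) hy)
    rwa [mem_smul_iff hx, inv_mul_cancel_left₀ hx] at this,
   fun h y hy => by
    rw [mem_smul_iff hx] at hy ⊢
    exact h hy⟩

/-- An element lying locally in a submodule at every maximal ideal lies in the submodule. -/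
theorem mem_of_locally {J : Submodule D K} {y : K}
    (h : ∀ M : MaximalSpectrum D, ∃ s ∉ M.asIdeal, s • y ∈ J) : y ∈ J := by
  let I : Ideal D :=
    { carrier := {s | s • y ∈ J}
      zero_mem' := by simp
      add_mem' := fun ha hb => by
        change _ • y ∈ J
        rw [add_smul]; exact add_mem ha hb
      smul_mem' := fun c a ha => by
        change _ • y ∈ J
        rw [smul_assoc]; exact J.smul_mem c ha }
  have hI : I = ⊤ := by
    by_contra hne
    obtain ⟨M, hM, hle⟩ := Ideal.exists_le_maximal I hne
    obtain ⟨s, hs, hy⟩ := h ⟨M, hM⟩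
    exact hs (hle hy)
  have : (1 : D) • y ∈ J := (Ideal.eq_top_iff_one I).1 hI
  rwa [one_smul] at this

variable (K) in
/-- The intersection of the localizations at the maximal ideals containing `q`. -/
def T (q : PrimeSpectrum D) : Set K :=
  {x | ∀ M : MaximalSpectrum D, q ≤ M.toPrimeSpectrum → x ∈ V K M.toPrimeSpectrum}

theorem exists_maximal_ge (q : PrimeSpectrum D) :
    ∃ M : MaximalSpectrum D, q ≤ M.toPrimeSpectrum := by
  obtain ⟨M, hM, hle⟩ := Ideal.exists_le_maximal q.asIdeal q.isPrime.ne_top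
  exact ⟨⟨M, hM⟩, hle⟩

theorem T_subset_V (q : PrimeSpectrum D) : T K q ⊆ V K q := fun _ hx =>
  let ⟨M, hM⟩ := exists_maximal_ge q
  V_anti hM (hx M hM)

variable (K) in
/-- The submodules strictly above the maximal ideal of the localization at `p`, contained in
this localization and stable under `R`. -/
abbrev Mod (p : PrimeSpectrum D) (R : Set K) :=
  {J : Submodule D K // m K p ≤ J ∧ (∃ y ∈ J, y ∉ m K p) ∧ J ≤ V K p ∧
    ∀ t ∈ R, t ∈ V K p → ∀ y ∈ J, t * y ∈ J}

variable (K) in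
/-- The units of the localization at `p`. -/
abbrev Un (p : PrimeSpectrum D) := {x : K // x ∈ V K p ∧ x ∉ m K p}

instance (p : PrimeSpectrum D) (R : Set K) : OrderTop (Mod K p R) where
  top := ⟨V K p, m_le_V, ⟨1, one_mem_V, one_notMem_m⟩, le_rfl, fun _ _ ht _ hy => mul_mem_V ht hy⟩
  le_top J := J.2.2.2.1

theorem Mod.coe_top {p : PrimeSpectrum D} {R : Set K} : ((⊤ : Mod K p R) : Submodule D K) = V K p :=
  rfl

variable [Fact (IsPrufer D K)]

namespace Un

variable {p q : PrimeSpectrum D}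

theorem ne_zero (x : Un K p) : (x : K) ≠ 0 := ne_zero_of_notMem x.2.2

theorem inv_mem (x : Un K p) : (x : K)⁻¹ ∈ V K p := inv_mem_V_of_notMem_m x.2.2

instance : One (Un K p) := ⟨⟨1, one_mem_V, one_notMem_m⟩⟩

instance : Inv (Un K p) := ⟨fun x => ⟨(x : K)⁻¹, x.inv_mem, inv_notMem_m x.ne_zero x.2.1⟩⟩

instance : Mul (Un K p) :=
  ⟨fun x y => ⟨x * y, mul_mem_V x.2.1 y.2.1, fun h => y.2.2 (mem_m_of_mul x.2.2 h)⟩⟩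

@[simp] theorem coe_inv (x : Un K p) : ((x⁻¹ : Un K p) : K) = (x : K)⁻¹ := rfl

theorem smul_V (x : Un K p) : (x : K) • V K p = V K p := by
  ext y
  rw [mem_smul_iff x.ne_zero]
  exact ⟨mem_V_of_mul (x⁻¹).2.2, mul_mem_V x.inv_mem⟩

theorem smul_m (x : Un K p) : (x : K) • m K p = m K p := by
  ext y
  rw [mem_smul_iff x.ne_zero]
  exact ⟨mem_m_of_mul (x⁻¹).2.2, mul_mem_m x.inv_mem⟩

/-- Units of a localization are units of any further localization. -/
def ofLE (h : p ≤ q) (x : Un K q) : Un K p :=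
  ⟨x, V_anti h x.2.1, fun hx => x.2.2 (m_mono h hx)⟩

end Un

/-- Multiplication by a unit of the localization. -/
def act (p : PrimeSpectrum D) (R : Set K) (x : Un K p) (J : Mod K p R) : Mod K p R :=
  ⟨(x : K) • J.1, by
    exact x.smul_m.ge.trans ((smul_le_smul_iff_of_ne x.ne_zero).2 J.2.1), by
    obtain ⟨y, hy, hy'⟩ := J.2.2.1
    exact ⟨x * y, mul_mem_smul hy, fun h => hy' (mem_m_of_mul x.2.2 h)⟩, by
    exact ((smul_le_smul_iff_of_ne x.ne_zero).2 J.2.2.2.1).trans x.smul_V.le, fun t ht ht' y hy => by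
    rw [mem_smul_iff x.ne_zero] at hy ⊢
    rw [mul_left_comm]
    exact J.2.2.2.2 t ht ht' _ hy⟩

section act

variable {p : PrimeSpectrum D} {R : Set K}

@[simp] theorem coe_act (x : Un K p) (J : Mod K p R) :
    (act p R x J : Submodule D K) = (x : K) • J.1 := rfl

theorem act_top (x : Un K p) : act p R x ⊤ = ⊤ := Subtype.ext x.smul_V

theorem act_one (J : Mod K p R) : act p R 1 J = J := Subtype.ext (one_smul K J.1)

theorem act_act (x y : Un K p) (J : Mod K p R) : act p R x (act p R y J) = act p R (x * y) J :=
  Subtype.ext (mul_smul _ _ J.1).symm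

theorem act_inv_act (x : Un K p) (J : Mod K p R) : act p R x⁻¹ (act p R x J) = J :=
  Subtype.ext (inv_smul_smul₀ x.ne_zero J.1)

theorem act_act_inv (x : Un K p) (J : Mod K p R) : act p R x (act p R x⁻¹ J) = J :=
  Subtype.ext (smul_inv_smul₀ x.ne_zero J.1)

theorem act_injective (x : Un K p) : Function.Injective (act p R x) :=
  Function.LeftInverse.injective (act_inv_act x)

theorem act_mono {x : Un K p} {J J' : Mod K p R} : act p R x J ≤ act p R x J' ↔ J ≤ J' :=
  smul_le_smul_iff_of_ne x.ne_zero

theorem Mod.exists_of_ne_top {J : Mod K p R} (h : J ≠ ⊤) : ∃ z ∈ V K p, z ∉ J.1 :=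
  SetLike.not_le_iff_exists.1 fun hle => h (top_le_iff.1 hle)

end act

variable (K) in
/-- Closure operators on `Mod K p R` commuting with multiplication by units. -/
abbrev Sys (p : PrimeSpectrum D) (R : Set K) := EqClo (act (K := K) p R)

instance (p : PrimeSpectrum D) (R : Set K) : OrderTop (Sys K p R) where
  top := ⟨fun _ => ⊤, fun _ => le_top, fun _ _ _ => le_rfl, fun _ => rfl,
    fun x _ => (act_top x).symm⟩
  le_top _ _ := le_top

variable (K) in
/-- The operators attached to a prime. -/
abbrev NSys (p : PrimeSpectrum D) := Sys K p ∅

variable (K) in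
/-- The operators attached to a branch above `p`. -/
abbrev ESys (p q : PrimeSpectrum D) := Sys K p (T K q)

variable (K) in
/-- The operators on modules over the localization at `q`. -/
abbrev HSys (p q : PrimeSpectrum D) := Sys K p (V K q : Set K)

end Modules

section Tree

variable {D : Type*} [CommRing D] [IsDomain D]
variable {K : Type*} [Field K] [Algebra D K] [IsFractionRing D K]

/-- `q` is directly above `p` in the tree `hiSpec D`. -/
abbrev Child (p q : PrimeSpectrum D) : Prop := DirectlyBelow D p.asIdeal q.asIdeal

theorem Child.lt {p q : PrimeSpectrum D} (h : Child p q) : p < q := h.2.2.1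

theorem exists_child_le [Finite (hiSpec D)] {p N : PrimeSpectrum D} (hp : p.asIdeal ∈ hiSpec D)
    (hN : N.asIdeal ∈ hiSpec D) (h : p < N) : ∃ q, Child p q ∧ q ≤ N := by
  have hfin : {R : Ideal D | R ∈ hiSpec D ∧ p.asIdeal < R ∧ R ≤ N.asIdeal}.Finite :=
    (Set.toFinite (hiSpec D)).subset fun R hR => hR.1
  obtain ⟨R, hR⟩ := hfin.exists_minimal ⟨N.asIdeal, hN, h, le_rfl⟩
  refine ⟨⟨R, hR.prop.1.1⟩, ⟨hp, hR.prop.1, hR.prop.2.1, fun R' hR' hpR' hlt => ?_⟩, hR.prop.2.2⟩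
  exact hlt.not_ge (hR.le_of_le ⟨hR', hpR', hlt.le.trans hR.prop.2.2⟩ hlt.le)

variable (K) [Fact (IsPrufer D K)]

theorem Child.not_le_of_ne {p q q' : PrimeSpectrum D} (h : Child p q) (h' : Child p q')
    (hne : q ≠ q') : ¬ q ≤ q' := fun hle =>
  h'.2.2.2 q.asIdeal h.2.1 h.lt (lt_of_le_of_ne hle fun h => hne (PrimeSpectrum.ext h))

theorem Child.eq_of_le (K : Type*) [Field K] [Algebra D K] [IsFractionRing D K]
    [Fact (IsPrufer D K)] {p q q' N : PrimeSpectrum D} (h : Child p q) (h' : Child p q')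
    (hq : q ≤ N) (hq' : q' ≤ N) : q = q' := by
  by_contra hne
  exact (le_or_le_of_le K hq hq').elim (h.not_le_of_ne h' hne) (h'.not_le_of_ne h (Ne.symm hne))

theorem Child.exists_dvd_mul (K : Type*) [Field K] [Algebra D K] [IsFractionRing D K]
    [Fact (IsPrufer D K)] {p q q' : PrimeSpectrum D} (h : Child p q) (h' : Child p q')
    (hne : q ≠ q') {M M' : MaximalSpectrum D} (hM : q ≤ M.toPrimeSpectrum)
    (hM' : q' ≤ M'.toPrimeSpectrum) {c : D} (hc : c ∉ p.asIdeal) :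
    ∃ s ∉ M.asIdeal, ∃ t ∉ M'.asIdeal, c ∣ s * t := by
  by_contra! hcon
  let R : Ideal D :=
    { carrier := {a | ∀ s ∉ M.asIdeal, ∀ t ∉ M'.asIdeal, ¬ a ∣ s * t}
      zero_mem' := fun s hs t ht hd => by
        rcases mul_eq_zero.1 (zero_dvd_iff.1 hd) with rfl | rfl
        · exact hs (zero_mem _)
        · exact ht (zero_mem _)
      add_mem' := by
        have key : ∀ a b : D, (∀ s ∉ M.asIdeal, ∀ t ∉ M'.asIdeal, ¬ b ∣ s * t) →
            (∃ z ∈ V K M.toPrimeSpectrum, algebraMap D K a = z * algebraMap D K b) →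
            ∀ s ∉ M.asIdeal, ∀ t ∉ M'.asIdeal, ¬ (a + b) ∣ s * t := by
          rintro a b hb ⟨z, hz, hab⟩ s hs t ht hd
          obtain ⟨u, hu, d, hd'⟩ := mem_V.1 hz
          have e : u * a = d * b := by
            apply IsFractionRing.injective D K
            rw [map_mul, map_mul, hab, ← hd']; ring
          refine hb (u * s) (fun h => (M.isMaximal.isPrime.mem_or_mem h).elim hu hs) t ht ?_
          have : b ∣ u * (a + b) := ⟨d + u, by rw [mul_add, e]; ring⟩
          rw [mul_assoc]
          exact this.trans (mul_dvd_mul_left u hd)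
        intro a b ha hb
        rcases eq_or_ne a 0 with rfl | ha0
        · rwa [zero_add]
        rcases eq_or_ne b 0 with rfl | hb0
        · rwa [add_zero]
        replace ha0 : algebraMap D K a ≠ 0 := by simpa using ha0
        replace hb0 : algebraMap D K b ≠ 0 := by simpa using hb0
        rcases mem_V_or_inv M.toPrimeSpectrum (algebraMap D K a / algebraMap D K b) with hx | hx
        · exact key a b hb ⟨_, hx, by field_simp⟩
        · change ∀ s ∉ M.asIdeal, ∀ t ∉ M'.asIdeal, ¬ (a + b) ∣ s * t
          rw [add_comm]
          exact key b a ha ⟨_, hx, by field_simp⟩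
      smul_mem' := fun d a ha s hs t ht hd => ha s hs t ht ((Dvd.intro_left d rfl).trans hd) }
  have hM1 : ∀ M : MaximalSpectrum D, (1 : D) ∉ M.asIdeal := fun M h =>
    M.isMaximal.ne_top ((Ideal.eq_top_iff_one _).2 h)
  have hmul : ∀ (M : MaximalSpectrum D) {a b : D}, a ∉ M.asIdeal → b ∉ M.asIdeal →
      a * b ∉ M.asIdeal := fun M _ _ ha hb h => (M.isMaximal.isPrime.mem_or_mem h).elim ha hb
  have hR : R.IsPrime := by
    refine Ideal.isPrime_iff.2 ⟨fun h => ?_, fun {a b} hab => ?_⟩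
    · exact (Ideal.eq_top_iff_one _).1 h 1 (hM1 M) 1 (hM1 M') (one_dvd _)
    · by_contra! hc
      obtain ⟨ha, hb⟩ := hc
      have ha : ¬ ∀ s ∉ M.asIdeal, ∀ t ∉ M'.asIdeal, ¬ a ∣ s * t := ha
      have hb : ¬ ∀ s ∉ M.asIdeal, ∀ t ∉ M'.asIdeal, ¬ b ∣ s * t := hb
      push Not at ha hb
      obtain ⟨s, hs, t, ht, hd⟩ := ha
      obtain ⟨s', hs', t', ht', hd'⟩ := hb
      refine hab (s * s') (hmul M hs hs') (t * t') (hmul M' ht ht') ?_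
      rw [mul_mul_mul_comm]
      exact mul_dvd_mul hd hd'
  have hRM : R ≤ M.asIdeal := fun a ha => by
    by_contra h
    exact ha a h 1 (hM1 M') (by simp)
  have hRM' : R ≤ M'.asIdeal := fun a ha => by
    by_contra h
    exact ha 1 (hM1 M) a h (by simp)
  have hlargest : ∀ P : Ideal D, P.IsPrime → P ≤ M.asIdeal → P ≤ M'.asIdeal → P ≤ R := by
    intro P hP h h' a ha s hs t ht hd
    exact (hP.mem_or_mem (P.mem_of_dvd hd ha)).elim (fun hh => hs (h hh)) fun hh => ht (h' hh)
  have hMM' : M ≠ M' := by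
    rintro rfl
    exact hne (h.eq_of_le K h' hM hM')
  have hnle : ∀ {N N' : MaximalSpectrum D}, N ≠ N' → ¬ N.asIdeal ≤ N'.asIdeal := fun {N N'} hN hle =>
    hN (MaximalSpectrum.ext (N.isMaximal.eq_of_le N'.isMaximal.ne_top hle))
  have hpR : p.asIdeal < R := by
    refine lt_of_le_of_ne (hlargest _ p.isPrime (h.lt.le.trans hM) (h'.lt.le.trans hM')) ?_
    intro hpR
    have hcR : c ∈ R := hcon
    exact hc (hpR ▸ hcR)
  have hRhi : R ∈ hiSpec D := by
    refine ⟨hR, Or.inr (Or.inr ⟨{M.asIdeal, M'.asIdeal}, ?_, ?_, ?_, ?_, ?_⟩)⟩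
    · rintro Q (rfl | rfl)
      exacts [M.isMaximal.isPrime, M'.isMaximal.isPrime]
    · rintro Q (rfl | rfl) Q' (rfl | rfl) hQ
      exacts [absurd rfl hQ, ⟨hnle hMM', hnle hMM'.symm⟩, ⟨hnle hMM'.symm, hnle hMM'⟩, absurd rfl hQ]
    · rintro (h | h)
      · exact hnle hMM' (h ▸ hRM')
      · exact hnle hMM'.symm ((show R = M'.asIdeal from h) ▸ hRM)
    · rintro Q (rfl | rfl)
      exacts [hRM, hRM']
    · exact fun P hP hle => hlargest P hP (hle _ (Or.inl rfl)) (hle _ (Or.inr rfl))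
  have hqR : ∀ {q : PrimeSpectrum D} {N : MaximalSpectrum D}, Child p q → q ≤ N.toPrimeSpectrum →
      R ≤ N.asIdeal → q ≤ ⟨R, hR⟩ := by
    intro q N hq hqN hRN
    rcases le_or_le_of_le K (p' := ⟨R, hR⟩) hqN hRN with hle | hle
    · exact hle
    · by_contra hne
      exact hq.2.2.2 R hRhi hpR (lt_of_le_not_ge hle hne)
  exact hne (h.eq_of_le K h' (hqR h hM hRM) (hqR h' hM' hRM'))

variable {K} in
theorem exists_notMem_of_child [Finite (MaximalSpectrum D)] {p r : PrimeSpectrum D}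
    (hr : Child p r) {N : MaximalSpectrum D} (hN : r ≤ N.toPrimeSpectrum) {c : D}
    (hc : c ∉ p.asIdeal) :
    ∃ d ∉ N.asIdeal, ∀ r', Child p r' → r' ≠ r →
      algebraMap D K d / algebraMap D K c ∈ T K r' := by
  have := Fintype.ofFinite (MaximalSpectrum D)
  have hc0 : algebraMap D K c ≠ 0 := algebraMap_ne_zero hc
  have key : ∀ M : MaximalSpectrum D, ∃ s ∉ N.asIdeal, ∀ r', Child p r' → r' ≠ r →
      r' ≤ M.toPrimeSpectrum → algebraMap D K s / algebraMap D K c ∈ V K M.toPrimeSpectrum := by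
    intro M
    by_cases hM : ∃ r', Child p r' ∧ r' ≠ r ∧ r' ≤ M.toPrimeSpectrum
    · obtain ⟨r', hr', hne, hle⟩ := hM
      obtain ⟨s, hs, t, ht, d, hd⟩ := hr.exists_dvd_mul K hr' hne.symm hN hle hc
      refine ⟨s, hs, fun _ _ _ _ => mem_V.2 ⟨t, ht, d, ?_⟩⟩
      rw [← mul_div_assoc, ← map_mul, mul_comm t, hd, map_mul, mul_div_cancel_left₀ _ hc0]
    · exact ⟨1, fun h => N.isMaximal.ne_top ((Ideal.eq_top_iff_one _).2 h),
        fun r' hr' hne hle => absurd ⟨r', hr', hne, hle⟩ hM⟩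
  choose s hs hsV using key
  classical
  refine ⟨∏ M, s M, fun h => ?_, fun r' hr' hne M hM => ?_⟩
  · obtain ⟨M, -, hM⟩ := (Ideal.IsPrime.prod_mem_iff (hp := N.isMaximal.isPrime)).1 h
    exact hs M hM
  · rw [← Finset.mul_prod_erase _ _ (Finset.mem_univ M), map_mul, mul_div_right_comm]
    exact mul_mem_V (hsV M r' hr' hne hM) (algebraMap_mem_V _)

variable {K} in
/-- Elements of `D` separating one branch above `p` from the others. -/
theorem exists_separating [Finite (MaximalSpectrum D)] [Finite (hiSpec D)]
    {p q : PrimeSpectrum D} (hq : Child p q) {c : D} (hc : c ∉ p.asIdeal) :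
    ∃ e : D, (algebraMap D K e - 1) / algebraMap D K c ∈ T K q ∧
      ∀ q', Child p q' → q' ≠ q → algebraMap D K e / algebraMap D K c ∈ T K q' := by
  have hc0 : algebraMap D K c ≠ 0 := algebraMap_ne_zero hc
  let A (r : PrimeSpectrum D) : Ideal D :=
    { carrier := {d | algebraMap D K d / algebraMap D K c ∈ T K r}
      zero_mem' := fun M hM => by simp
      add_mem' := fun ha hb M hM => by
        rw [map_add, add_div]
        exact add_mem (ha M hM) (hb M hM)
      smul_mem' := fun d a ha M hM => by
        rw [smul_eq_mul, map_mul, mul_div_assoc]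
        exact mul_mem_V (algebraMap_mem_V _) (ha M hM) }
  let B : Ideal D := ⨅ r ∈ {r | Child p r ∧ r ≠ q}, A r
  have hB : ∀ d, d ∈ B ↔ ∀ q', Child p q' → q' ≠ q →
      algebraMap D K d / algebraMap D K c ∈ T K q' := by
    intro d
    simp only [B, Ideal.mem_iInf, Set.mem_ofPred_eq, and_imp]
    exact Iff.rfl
  have htop : A q ⊔ B = ⊤ := by
    by_contra hne
    obtain ⟨N, hN, hle⟩ := Ideal.exists_le_maximal _ hne
    let N' : MaximalSpectrum D := ⟨N, hN⟩
    have hpA : p.asIdeal ≤ A q := by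
      intro d hd M hM
      refine m_le_V_of_le (hq.lt.le.trans hM) ?_
      rw [div_eq_mul_inv, mul_comm]
      exact mul_mem_m (inv_mem_V_of_notMem_m (by rwa [algebraMap_mem_m])) (algebraMap_mem_m.2 hd)
    have hpN : p ≤ N'.toPrimeSpectrum := hpA.trans (le_sup_left.trans hle)
    have hlt : p < N'.toPrimeSpectrum := by
      refine lt_of_le_of_ne hpN ?_
      rintro rfl
      obtain ⟨M, hM⟩ := exists_maximal_ge q
      exact (hq.lt.trans_le hM).ne
        (PrimeSpectrum.ext (hN.eq_of_le M.isMaximal.ne_top (hq.lt.le.trans hM)))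
    obtain ⟨r, hr, hrN⟩ := exists_child_le hq.1 (maximal_mem_hiSpec hN) hlt
    obtain ⟨d, hd, hdT⟩ := exists_notMem_of_child (K := K) hr (N := N') hrN hc
    by_cases hrq : r = q
    · subst hrq
      exact hd (hle (le_sup_right (a := A r) ((hB d).2 hdT)))
    · exact hd (hle (le_sup_left (b := B) (hdT q hq (Ne.symm hrq) : d ∈ A q)))
  obtain ⟨f, hf, e, he, hfe⟩ := Submodule.mem_sup.1 ((Ideal.eq_top_iff_one _).1 htop)
  refine ⟨e, ?_, (hB e).1 he⟩
  have : algebraMap D K e - 1 = algebraMap D K (-f) := by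
    rw [← map_one (algebraMap D K), ← hfe, map_add, map_neg]; ring
  rw [this]
  exact (A q).neg_mem hf

end Tree

section Branches

variable {D : Type*} [CommRing D] [IsDomain D]
variable {K : Type*} [Field K] [Algebra D K] [IsFractionRing D K] [Fact (IsPrufer D K)]
variable {p q : PrimeSpectrum D}

theorem m_subset_T : (m K q : Set K) ⊆ T K q := fun _ hx _ hM => m_le_V (m_mono hM hx)

theorem mem_T_of_sub_one_mem {u : K} (h : u - 1 ∈ m K q) : u ∉ m K q ∧ u ∈ T K q ∧ u⁻¹ ∈ T K q := by
  have key : ∀ {r : PrimeSpectrum D}, q ≤ r → u ∉ m K r := fun hr hu =>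
    one_notMem_m (K := K) (by simpa using sub_mem hu (m_mono hr h))
  refine ⟨key le_rfl, fun M hM => ?_, fun M hM => inv_mem_V_of_notMem_m (key hM)⟩
  have := add_mem (m_le_V (m_mono hM h)) (one_mem_V (K := K))
  simpa using this

theorem exists_mem_not_mem_of_lt (h : p < q) : ∃ a ∈ q.asIdeal, a ∉ p.asIdeal :=
  SetLike.not_le_iff_exists.1 fun hle => h.not_ge hle

theorem exists_algebraMap_mul {x : K} (hx : x ∈ V K p) :
    ∃ s ∉ p.asIdeal, ∃ a : D, algebraMap D K s * x = algebraMap D K a := mem_V.1 hx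

theorem mul_notMem {a b : D} (ha : a ∉ p.asIdeal) (hb : b ∉ p.asIdeal) : a * b ∉ p.asIdeal :=
  fun h => (p.isPrime.mem_or_mem h).elim ha hb

theorem Mod.exists_smul_mem {R : Set K} (J : Mod K p R) {y : K} (hy : y ∈ V K p) :
    ∃ s ∉ p.asIdeal, s • y ∈ J.1 := by
  obtain ⟨z, hz, hz'⟩ := J.2.2.1
  obtain ⟨s, hs, a, h⟩ := exists_algebraMap_mul (mul_mem_V hy (inv_mem_V_of_notMem_m hz'))
  refine ⟨s, hs, ?_⟩
  have : s • y = a • z := by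
    rw [Algebra.smul_def, Algebra.smul_def, ← h]
    have := ne_zero_of_notMem hz'
    field_simp
  rw [this]
  exact J.1.smul_mem a hz

theorem Mod.T_mul_mem (hpq : p ≤ q) (J : Mod K p (T K q)) {t y : K} (ht : t ∈ T K q)
    (hy : y ∈ J.1) : t * y ∈ J.1 :=
  J.2.2.2.2 t ht (V_anti hpq (T_subset_V q ht)) y hy

theorem Mod.smul_eq_of_mem_T (hpq : p ≤ q) (J : Mod K p (T K q)) {u : K} (hu : u ∈ T K q)
    (hu' : u⁻¹ ∈ T K q) (hu0 : u ≠ 0) : u • J.1 = J.1 := by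
  ext y
  rw [mem_smul_iff hu0]
  refine ⟨fun h => ?_, J.T_mul_mem hpq hu'⟩
  rw [← mul_inv_cancel_left₀ hu0 y]
  exact J.T_mul_mem hpq hu h

/-- Away from its branch, `T K q` contains large multiples of the inverse of any `c ∉ p`. -/
theorem exists_notMem_div_mem_T [Finite (MaximalSpectrum D)] [Finite (hiSpec D)]
    (h : Child p q) {M : MaximalSpectrum D} (hM : ¬ q ≤ M.toPrimeSpectrum) {c : D}
    (hc : c ∉ p.asIdeal) :
    ∃ d ∉ M.asIdeal, algebraMap D K d / algebraMap D K c ∈ T K q := by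
  by_cases hpM : p ≤ M.toPrimeSpectrum
  · rcases hpM.eq_or_lt with rfl | hlt
    · exact ⟨c, hc, by
        rw [div_self (algebraMap_ne_zero hc)]
        exact fun _ _ => one_mem_V⟩
    · obtain ⟨r, hr, hrM⟩ := exists_child_le h.1 (maximal_mem_hiSpec M.isMaximal) hlt
      obtain ⟨d, hd, hdT⟩ := exists_notMem_of_child (K := K) hr hrM hc
      exact ⟨d, hd, hdT q h fun hqr => hM (hqr ▸ hrM)⟩
  · obtain ⟨d, hd, hdM⟩ := SetLike.not_le_iff_exists.1
      (fun hle => hpM hle : ¬ p.asIdeal ≤ M.asIdeal)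
    refine ⟨d, hdM, fun N hN => ?_⟩
    refine m_le_V (m_mono (h.lt.le.trans hN) ?_)
    rw [div_eq_mul_inv, mul_comm]
    exact mul_mem_m (inv_mem_V_of_notMem_m (by rwa [algebraMap_mem_m])) (algebraMap_mem_m.2 hd)

theorem exists_act_le (hpq : p < q) {R : Set K}
    (hR : (m K q : Set K) ⊆ R) (J J' : Mod K p R) (hJ' : J' ≠ ⊤) :
    ∃ x, act p _ x J' ≤ J := by
  obtain ⟨z, hz, hzJ'⟩ := Mod.exists_of_ne_top hJ'
  obtain ⟨y, hy, hy'⟩ := J.2.2.1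
  obtain ⟨a, haq, hap⟩ := exists_mem_not_mem_of_lt hpq
  have hz' : z ∉ m K p := fun h => hzJ' (J'.2.1 h)
  have hap' : algebraMap D K a ∉ m K p := by rwa [algebraMap_mem_m]
  let u : Un K p := ⟨z, hz, hz'⟩
  let v : Un K p := ⟨y, J.2.2.2.1 hy, hy'⟩
  let w : Un K p := ⟨algebraMap D K a, algebraMap_mem_V a, hap'⟩
  have hmV : ∀ t ∈ m K q, t ∈ V K p := fun t ht => V_anti hpq.le (m_le_V ht)
  refine ⟨w * v * u⁻¹, fun t ht => ?_⟩
  rw [coe_act, mem_smul_iff (Un.ne_zero _)] at ht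
  set t' := ((w * v * u⁻¹ : Un K p) : K)⁻¹ * t with ht'
  have htt : t = algebraMap D K a * (t' / z) * y := by
    have e : t = ((w * v * u⁻¹ : Un K p) : K) * t' := (mul_inv_cancel_left₀ (Un.ne_zero _) t).symm
    rw [e]
    change algebraMap D K a * y * z⁻¹ * t' = _
    ring
  have hV : t' / z ∈ V K q := by
    by_contra h
    have h1 := inv_mem_m h
    have h2 := J'.2.2.2.2 _ (hR h1) (hmV _ h1) t' ht
    have : t' ≠ 0 := fun h0 => h (by simp [h0])
    rw [inv_div, div_mul_cancel₀ _ this] at h2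
    exact hzJ' h2
  have h3 : algebraMap D K a * (t' / z) ∈ m K q := by
    rw [mul_comm]; exact mul_mem_m hV (algebraMap_mem_m.2 haq)
  rw [htt]
  exact J.2.2.2.2 _ (hR h3) (hmV _ h3) y hy

theorem not_V_le_V (hpq : p < q) : ¬ V K p ≤ V K q := fun hle => by
  obtain ⟨a, haq, hap⟩ := exists_mem_not_mem_of_lt hpq
  have h1 : (algebraMap D K a)⁻¹ ∈ V K p :=
    inv_mem_V_of_notMem_m (by rwa [algebraMap_mem_m])
  exact inv_notMem_V (algebraMap_ne_zero hap) (algebraMap_mem_m.2 haq) (hle h1)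

/-- The localization at `q` as a module over a branch. -/
def Mod.ofV (hpq : p ≤ q) (R : Set K) (hR : R ⊆ V K q) : Mod K p R :=
  ⟨V K q, m_le_V_of_le hpq, ⟨1, one_mem_V, one_notMem_m⟩, V_anti hpq,
    fun _ ht _ _ hy => mul_mem_V (hR ht) hy⟩

/-- Intersection of modules over the branches. -/
def inter {ι : Type*} [Finite ι] {q : ι → PrimeSpectrum D}
    (J : ∀ i, Mod K p (T K (q i))) : Mod K p ∅ :=
  ⟨V K p ⊓ ⨅ i, (J i).1, le_inf m_le_V (le_iInf fun i => (J i).2.1), by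
    have := Fintype.ofFinite ι
    have key : ∀ i, ∃ a ∉ p.asIdeal, algebraMap D K a ∈ (J i).1 := fun i => by
      obtain ⟨s, hs, h⟩ := (J i).exists_smul_mem (one_mem_V (K := K))
      exact ⟨s, hs, by rwa [Algebra.smul_def, mul_one] at h⟩
    choose a ha haJ using key
    classical
    refine ⟨algebraMap D K (∏ i, a i), ⟨algebraMap_mem_V _, ?_⟩, ?_⟩
    · refine Submodule.mem_iInf _ |>.2 fun i => ?_
      rw [← Finset.prod_erase_mul _ _ (Finset.mem_univ i), map_mul, ← Algebra.smul_def]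
      exact (J i).1.smul_mem _ (haJ i)
    · rw [algebraMap_mem_m]
      intro h
      obtain ⟨i, -, hi⟩ := (Ideal.IsPrime.prod_mem_iff (hp := p.isPrime)).1 h
      exact ha i hi, inf_le_left, fun _ h => h.elim⟩

variable [Finite (MaximalSpectrum D)] [Finite (hiSpec D)]

/-- Modules over `T K q` are determined by the localizations at maximal ideals above `q`. -/
theorem mem_of_locally_of_T (h : Child p q) {J : Submodule D K}
    (hJ : ∀ t ∈ T K q, ∀ y ∈ J, t * y ∈ J) {y : K}
    (hy : ∀ M : MaximalSpectrum D, q ≤ M.toPrimeSpectrum → ∃ s ∉ M.asIdeal, s • y ∈ J) :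
    y ∈ J := by
  refine mem_of_locally fun M => ?_
  by_cases hM : q ≤ M.toPrimeSpectrum
  · exact hy M hM
  · obtain ⟨N, hN⟩ := exists_maximal_ge q
    obtain ⟨c, hc, hcy⟩ := hy N hN
    have hc : c ∉ p.asIdeal := fun h' => hc ((h.lt.le.trans hN) h')
    obtain ⟨d, hd, hdT⟩ := exists_notMem_div_mem_T (K := K) h hM hc
    refine ⟨d, hd, ?_⟩
    have := hJ _ hdT _ hcy
    rwa [Algebra.smul_def, ← mul_assoc, div_mul_cancel₀ _ (algebraMap_ne_zero hc),
      ← Algebra.smul_def] at this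

/-- The module generated over `T K q`. -/
def hull (h : p ≤ q) (J : Mod K p ∅) : Mod K p (T K q) :=
  ⟨{ carrier := {y | ∀ M : MaximalSpectrum D, q ≤ M.toPrimeSpectrum → ∃ s ∉ M.asIdeal, s • y ∈ J.1}
     zero_mem' := fun M _ => ⟨1, fun h' => M.isMaximal.ne_top ((Ideal.eq_top_iff_one _).2 h'),
       by simp⟩
     add_mem' := fun {x y} hx hy M hM => by
      obtain ⟨s, hs, hsx⟩ := hx M hM
      obtain ⟨t, ht, hty⟩ := hy M hM
      refine ⟨s * t, mul_notMem (p := M.toPrimeSpectrum) hs ht, ?_⟩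
      rw [smul_add]
      refine add_mem ?_ ?_
      · rw [mul_comm, mul_smul]; exact J.1.smul_mem t hsx
      · rw [mul_smul]; exact J.1.smul_mem s hty
     smul_mem' := fun d y hy M hM => by
      obtain ⟨s, hs, hsy⟩ := hy M hM
      exact ⟨s, hs, by rw [smul_comm]; exact J.1.smul_mem d hsy⟩ },
    fun y hy M _ => ⟨1, fun h' => M.isMaximal.ne_top ((Ideal.eq_top_iff_one _).2 h'),
      by rw [one_smul]; exact J.2.1 hy⟩, by
    obtain ⟨y, hy, hy'⟩ := J.2.2.1
    exact ⟨y, fun M _ => ⟨1, fun h' => M.isMaximal.ne_top ((Ideal.eq_top_iff_one _).2 h'),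
      by rw [one_smul]; exact hy⟩, hy'⟩, fun y hy => by
    obtain ⟨M, hM⟩ := exists_maximal_ge q
    obtain ⟨s, hs, hsy⟩ := hy M hM
    refine mem_V_of_mul (x := algebraMap D K s) ?_ (Algebra.smul_def s y ▸ J.2.2.2.1 hsy)
    rw [algebraMap_mem_m]
    exact fun h' => hs ((h.trans hM) h'), fun t ht _ y hy M hM => by
    obtain ⟨s, hs, hsy⟩ := hy M hM
    obtain ⟨u, hu, a, ha⟩ := exists_algebraMap_mul (ht M hM)
    refine ⟨u * s, mul_notMem (p := M.toPrimeSpectrum) hu hs, ?_⟩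
    have : (u * s) • (t * y) = a • s • y := by
      simp only [Algebra.smul_def, map_mul, ← ha]; ring
    rw [this]
    exact J.1.smul_mem a hsy⟩

theorem mem_hull (h : p ≤ q) (J : Mod K p ∅) {y : K} : y ∈ (hull h J).1 ↔
    ∀ M : MaximalSpectrum D, q ≤ M.toPrimeSpectrum → ∃ s ∉ M.asIdeal, s • y ∈ J.1 := Iff.rfl

theorem le_hull (h : p ≤ q) (J : Mod K p ∅) : J.1 ≤ (hull h J).1 := fun y hy M _ =>
  ⟨1, fun h' => M.isMaximal.ne_top ((Ideal.eq_top_iff_one _).2 h'), by rwa [one_smul]⟩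

theorem hull_act (h : p ≤ q) (x : Un K p) (J : Mod K p ∅) :
    hull h (act p ∅ x J) = act p _ x (hull h J) := by
  refine Subtype.ext (Submodule.ext fun y => ?_)
  rw [coe_act, mem_smul_iff x.ne_zero, mem_hull, mem_hull]
  simp only [coe_act, mem_smul_iff x.ne_zero, Algebra.smul_def, mul_left_comm]

theorem hull_mono (h : p ≤ q) {J J' : Mod K p ∅} (hJ : J ≤ J') : hull h J ≤ hull h J' :=
  fun _ hy M hM => let ⟨s, hs, hsy⟩ := hy M hM; ⟨s, hs, hJ hsy⟩

variable {ι : Type*} [Finite ι] {q : ι → PrimeSpectrum D}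

theorem inter_hull (hp : p.asIdeal ∈ hiSpec D) (hq : ∀ i, Child p (q i))
    (hsurj : ∀ r, Child p r → ∃ i, q i = r) (J : Mod K p ∅) :
    inter (fun i => hull (hq i).lt.le J) = J := by
  refine Subtype.ext (le_antisymm ?_ (le_inf J.2.2.2.1 (le_iInf fun i => le_hull _ J)))
  rintro y ⟨hyV, hy⟩
  have hy : ∀ i, y ∈ (hull (hq i).lt.le J).1 := Submodule.mem_iInf _ |>.1 hy
  refine mem_of_locally fun M => ?_
  by_cases hpM : p ≤ M.toPrimeSpectrum
  · rcases hpM.eq_or_lt with h | hlt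
    · obtain ⟨s, hs, h'⟩ := J.exists_smul_mem hyV
      exact ⟨s, fun hsM => hs (h ▸ hsM), h'⟩
    · obtain ⟨r, hr, hrM⟩ := exists_child_le hp (maximal_mem_hiSpec M.isMaximal) hlt
      obtain ⟨i, rfl⟩ := hsurj r hr
      exact hy i M hrM
  · obtain ⟨d, hd, hdM⟩ := SetLike.not_le_iff_exists.1
      (fun hle => hpM hle : ¬ p.asIdeal ≤ M.asIdeal)
    refine ⟨d, hdM, J.2.1 ?_⟩
    rw [Algebra.smul_def, mul_comm]
    exact mul_mem_m hyV (algebraMap_mem_m.2 hd)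

theorem hull_inter (hq : ∀ i, Child p (q i)) (hinj : Function.Injective q)
    (J : ∀ i, Mod K p (T K (q i))) (j : ι) : hull (hq j).lt.le (inter J) = J j := by
  have := Fintype.ofFinite ι
  classical
  refine Subtype.ext (le_antisymm (fun y hy => ?_) fun y hy M hM => ?_)
  · refine mem_of_locally_of_T (hq j) (fun t ht y hy => (J j).T_mul_mem (hq j).lt.le ht hy)
      fun M hM => ?_
    obtain ⟨s, hs, h⟩ := hy M hM
    exact ⟨s, hs, Submodule.mem_iInf _ |>.1 h.2 j⟩
  · have hyV := (J j).2.2.2.1 hy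
    choose c hc hcy using fun i => (J i).exists_smul_mem hyV
    obtain ⟨a, haq, hap⟩ := exists_mem_not_mem_of_lt (hq j).lt
    have hC : a * ∏ i, c i ∉ p.asIdeal := mul_notMem hap fun h => by
      obtain ⟨i, -, hi⟩ := (Ideal.IsPrime.prod_mem_iff (hp := p.isPrime)).1 h
      exact hc i hi
    obtain ⟨e, he, he'⟩ := exists_separating (K := K) (hq j) hC
    have hC0 := algebraMap_ne_zero (K := K) hC
    have heM : e ∉ M.asIdeal := fun h => by
      have h1 : algebraMap D K (a * ∏ i, c i) ∈ m K M.toPrimeSpectrum :=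
        algebraMap_mem_m.2 (Ideal.mul_mem_right _ _ (hM haq))
      have h2 := mul_mem_m (he M hM) h1
      rw [div_mul_cancel₀ _ hC0] at h2
      have h3 : algebraMap D K e ∈ m K M.toPrimeSpectrum := algebraMap_mem_m.2 h
      exact one_notMem_m (K := K) (by simpa using sub_mem h3 h2)
    refine ⟨e, heM, Submodule.smul_mem _ e hyV, Submodule.mem_iInf _ |>.2 fun i => ?_⟩
    by_cases hij : i = j
    · subst hij
      exact (J i).1.smul_mem e hy
    · have h1 : (a * ∏ i, c i) • y ∈ (J i).1 := by
        rw [← Finset.prod_erase_mul _ _ (Finset.mem_univ i), ← mul_assoc, mul_smul]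
        exact (J i).1.smul_mem _ (hcy i)
      have h2 := (J i).T_mul_mem (hq i).lt.le (he' (q i) (hq i) fun h => hij (hinj h)) h1
      rwa [Algebra.smul_def, ← mul_assoc, div_mul_cancel₀ _ hC0, ← Algebra.smul_def] at h2

/-- A module between the maximal ideal and the localization at `p` is the same as
a family of modules over the branches above `p`. -/
def branchIso (hp : p.asIdeal ∈ hiSpec D) (hq : ∀ i, Child p (q i))
    (hinj : Function.Injective q) (hsurj : ∀ r, Child p r → ∃ i, q i = r) :
    Mod K p ∅ ≃o ∀ i, Mod K p (T K (q i)) where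
  toFun J i := hull (hq i).lt.le J
  invFun := inter
  left_inv := inter_hull hp hq hsurj
  right_inv J := funext (hull_inter hq hinj J)
  map_rel_iff' := by
    intro J J'
    refine ⟨fun h => ?_, fun h i => hull_mono (hq i).lt.le h⟩
    rw [← inter_hull hp hq hsurj J, ← inter_hull hp hq hsurj J']
    exact fun y hy => ⟨hy.1, Submodule.mem_iInf _ |>.2 fun i => h i (Submodule.mem_iInf _ |>.1 hy.2 i)⟩

/-- Units can be approximated independently on the branches. -/
theorem exists_act_eq (hq : ∀ i, Child p (q i)) (hinj : Function.Injective q) (x : ι → Un K p) :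
    ∃ z : Un K p, ∀ i (J : Mod K p (T K (q i))), act p _ z J = act p _ (x i) J := by
  have := Fintype.ofFinite ι
  classical
  rcases isEmpty_or_nonempty ι with hι | ⟨⟨i₀⟩⟩
  · exact ⟨1, fun i => hι.elim i⟩
  have key : ∀ ij : ι × ι, ∃ c ∉ p.asIdeal,
      algebraMap D K c * (x ij.1 / x ij.2 : K) ∈ m K (q ij.2) := by
    rintro ⟨i, j⟩
    obtain ⟨a, haq, hap⟩ := exists_mem_not_mem_of_lt (hq j).lt
    obtain ⟨s, hs, b, hb⟩ := exists_algebraMap_mul (mul_mem_V (x i).2.1 (x j).inv_mem)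
    refine ⟨s * a, mul_notMem hs hap, ?_⟩
    rw [map_mul, mul_right_comm, div_eq_mul_inv, hb]
    exact mul_mem_m (algebraMap_mem_V _) (algebraMap_mem_m.2 haq)
  choose c hc hcx using key
  set C := ∏ ij, c ij with hCdef
  have hC : C ∉ p.asIdeal := fun h => by
    obtain ⟨i, -, hi⟩ := (Ideal.IsPrime.prod_mem_iff (hp := p.isPrime)).1 h
    exact hc i hi
  have hC0 := algebraMap_ne_zero (K := K) hC
  have hCx : ∀ i j, algebraMap D K C * (x i / x j : K) ∈ m K (q j) := fun i j => by
    rw [hCdef, ← Finset.prod_erase_mul _ _ (Finset.mem_univ (i, j)), map_mul, mul_assoc]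
    exact mul_mem_m (algebraMap_mem_V _) (hcx (i, j))
  choose e he he' using fun i => exists_separating (K := K) (hq i) hC
  set z : K := ∑ i, algebraMap D K (e i) * x i with hz
  have hzj : ∀ j, z / x j - 1 ∈ m K (q j) := by
    intro j
    have : z / x j - 1 = ∑ i, (algebraMap D K (e i) - if i = j then 1 else 0) / algebraMap D K C *
        (algebraMap D K C * (x i / x j)) := by
      have h0 : ∀ i, (algebraMap D K (e i) - if i = j then 1 else 0) / algebraMap D K C *
          (algebraMap D K C * (x i / x j)) =
          algebraMap D K (e i) * x i / x j - if i = j then 1 else 0 := by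
        intro i
        rw [← mul_assoc, div_mul_cancel₀ _ hC0]
        split_ifs with h
        · subst h
          have := (x i).ne_zero
          field_simp
        · ring
      rw [Finset.sum_congr rfl fun i _ => h0 i, Finset.sum_sub_distrib, ← Finset.sum_div]
      simp [hz]
    rw [this]
    refine sum_mem fun i _ => mul_mem_m (T_subset_V _ ?_) (hCx i j)
    split_ifs with h
    · subst h; exact he i
    · rw [sub_zero]
      exact he' i (q j) (hq j) fun hh => h (hinj hh).symm
  have hzp : z ∉ m K p := fun h => by
    have h1 : z / x i₀ ∈ m K p := by
      rw [div_eq_mul_inv, mul_comm]; exact mul_mem_m (x i₀).inv_mem h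
    exact (mem_T_of_sub_one_mem (hzj i₀)).1 (m_mono (hq i₀).lt.le h1)
  have hzV : z ∈ V K p := sum_mem fun i _ => mul_mem_V (algebraMap_mem_V _) (x i).2.1
  refine ⟨⟨z, hzV, hzp⟩, fun i J => Subtype.ext ?_⟩
  obtain ⟨h1, h2, h3⟩ := mem_T_of_sub_one_mem (hzj i)
  rw [coe_act, coe_act]
  change z • J.1 = _
  have : z = (x i : K) * (z / x i) := by
    have := (x i).ne_zero
    field_simp
  rw [this, mul_smul, J.smul_eq_of_mem_T (hq i).lt.le h2 h3 (ne_zero_of_notMem h1)]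

theorem nonempty_NSys_orderIso (hp : p.asIdeal ∈ hiSpec D) (hq : ∀ i, Child p (q i))
    (hinj : Function.Injective q) (hsurj : ∀ r, Child p r → ∃ i, q i = r) :
    Nonempty (NSys K p ≃o Str fun i => ESys K p (q i)) := by
  let Θ := branchIso (K := K) hp hq hinj hsurj
  have hΘ : ∀ x J, piAct (fun i => act (K := K) p (T K (q i))) x (Θ J) = Θ (act p ∅ x J) :=
    fun x J => funext fun i => (hull_act (hq i).lt.le x J).symm
  obtain ⟨Ψ⟩ := EqClo.nonempty_pi_orderIso (act := fun i => act (K := K) p (T K (q i)))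
    (fun i => act_top) (fun i => act_injective) ⟨1, fun i => act_one⟩
    (exists_act_eq hq hinj) (fun i => exists_act_le (hq i).lt m_subset_T)
    (fun i => Mod.ofV (hq i).lt.le _ (T_subset_V _))
    (fun i h => not_V_le_V (hq i).lt (congrArg Subtype.val h).ge)
  exact ⟨(EqClo.congr Θ (fun x => ⟨x, hΘ x⟩) fun x => ⟨x, hΘ x⟩).trans Ψ⟩

end Branches

section BranchOperators

variable {D : Type*} [CommRing D] [IsDomain D]
variable {K : Type*} [Field K] [Algebra D K] [IsFractionRing D K] [Fact (IsPrufer D K)]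
variable {p q : PrimeSpectrum D} {R : Set K}

instance : OrderBot (Sys K p R) where
  bot := ⟨id, fun _ => le_rfl, fun _ _ h => h, fun _ => rfl, fun _ _ => rfl⟩
  bot_le c := c.2.1

theorem Sys.apply_eq_of_le {c c' : Sys K p R} (h : c ≤ c') {J : Mod K p R} (hJ : c'.1 J = J) :
    c.1 J = J := le_antisymm ((h J).trans hJ.le) (c.2.1 J)

/-- The closure operator whose closed modules are the intersections of a family invariant
under units. -/
def Sys.ofFamily (F : Set (Mod K p R)) (hF : ∀ x, ∀ C ∈ F, act p R x C ∈ F) : Sys K p R :=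
  ⟨fun J => ⟨V K p ⊓ ⨅ C ∈ {C | C ∈ F ∧ J ≤ C}, C.1,
      le_inf m_le_V (le_iInf₂ fun C _ => C.2.1), by
      obtain ⟨y, hy, hy'⟩ := J.2.2.1
      exact ⟨y, ⟨J.2.2.2.1 hy, by
        simp only [SetLike.mem_coe, Submodule.mem_iInf]
        exact fun C hC => hC.2 hy⟩, hy'⟩,
      inf_le_left, fun t ht ht' y hy => ⟨mul_mem_V ht' hy.1, by
        have := hy.2
        simp only [SetLike.mem_coe, Submodule.mem_iInf] at this ⊢
        exact fun C hC => C.2.2.2.2 t ht ht' y (this C hC)⟩⟩, by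
    have key : ∀ {J C : Mod K p R}, C ∈ F → J ≤ C →
        V K p ⊓ ⨅ C ∈ {C | C ∈ F ∧ J ≤ C}, C.1 ≤ C.1 := fun hC hJ =>
      inf_le_right.trans (iInf₂_le _ ⟨hC, hJ⟩)
    have hle : ∀ J : Mod K p R, J.1 ≤ V K p ⊓ ⨅ C ∈ {C | C ∈ F ∧ J ≤ C}, C.1 := fun J =>
      le_inf J.2.2.2.1 (le_iInf₂ fun C hC => hC.2)
    refine ⟨hle, fun J J' hJ => ?_, fun J => Subtype.ext (le_antisymm ?_ (hle _)), fun x J => ?_⟩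
    · exact le_inf inf_le_left (le_iInf₂ fun C hC => key hC.1 (hJ.trans hC.2))
    · exact le_inf inf_le_left (le_iInf₂ fun C hC => key hC.1 (key hC.1 hC.2))
    · refine Subtype.ext (Submodule.ext fun y => ?_)
      rw [coe_act, mem_smul_iff x.ne_zero]
      simp only [Submodule.mem_inf, Submodule.mem_iInf]
      refine and_congr ⟨mul_mem_V x.inv_mem, mem_V_of_mul (x⁻¹).2.2⟩
        ⟨fun h C hC => ?_, fun h C hC => ?_⟩
      · have := h (act p R x C) ⟨hF x C hC.1, act_mono.2 hC.2⟩
        rwa [coe_act, mem_smul_iff x.ne_zero] at this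
      · have h1 : J ≤ act p R x⁻¹ C := by
          rw [← act_mono (x := x), act_act_inv]; exact hC.2
        have := h _ ⟨hF _ C hC.1, h1⟩
        rwa [coe_act, mem_smul_iff (x⁻¹).ne_zero, Un.coe_inv, inv_inv,
          mul_inv_cancel_left₀ x.ne_zero] at this⟩

section ofFamily

variable {F : Set (Mod K p R)} {hF : ∀ x, ∀ C ∈ F, act p R x C ∈ F}

theorem Sys.ofFamily_apply_le {J C : Mod K p R} (hC : C ∈ F) (h : J ≤ C) :
    (ofFamily F hF).1 J ≤ C := by
  change V K p ⊓ (⨅ C' ∈ {C' | C' ∈ F ∧ J ≤ C'}, C'.1) ≤ C.1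
  exact inf_le_right.trans (iInf₂_le C ⟨hC, h⟩)

theorem Sys.le_ofFamily_apply {J B : Mod K p R} (h : ∀ C ∈ F, J ≤ C → B ≤ C) :
    B ≤ (ofFamily F hF).1 J := le_inf B.2.2.2.1 (le_iInf₂ fun C hC => h C hC.1 hC.2)

theorem Sys.ofFamily_apply_eq {C : Mod K p R} (hC : C ∈ F) : (ofFamily F hF).1 C = C :=
  le_antisymm (ofFamily_apply_le hC le_rfl) ((ofFamily F hF).2.1 C)

theorem Sys.ofFamily_le {c : Sys K p R} (h : ∀ J, c.1 J ∈ F) : ofFamily F hF ≤ c := fun J =>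
  ofFamily_apply_le (h J) (c.2.1 J)

theorem Sys.le_ofFamily {c : Sys K p R} (h : ∀ C ∈ F, c.1 C = C) : c ≤ ofFamily F hF := fun _ =>
  le_ofFamily_apply fun C hC hJ => (c.2.2.1 hJ).trans (h C hC).le

end ofFamily

/-- Stability under the localization at `q`. -/
def Stab (q : PrimeSpectrum D) (J : Submodule D K) : Prop := ∀ v ∈ V K q, ∀ y ∈ J, v * y ∈ J

theorem Stab.smul {J : Submodule D K} (h : Stab q J) {x : K} (hx : x ≠ 0) : Stab q (x • J) := by
  intro v hv y hy
  rw [mem_smul_iff hx] at hy ⊢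
  rw [mul_left_comm]
  exact h v hv _ hy

theorem Stab.V_le {J : Submodule D K} (h : Stab q J) {y : K} (hy : y ∈ J) (hy' : y ∉ m K q) :
    V K q ≤ J := fun v hv => by
  have := h _ (mul_mem_V hv (inv_mem_V_of_notMem_m hy')) y hy
  rwa [inv_mul_cancel_right₀ (ne_zero_of_notMem hy')] at this

theorem Stab.le_smul_m {J : Submodule D K} (h : Stab q J) {z : K} (hz : z ∉ J) :
    J ≤ z • m K q := fun w hw => by
  have hz0 := ne_zero_of_notMem hz
  rw [mem_smul_iff hz0]
  by_contra hc
  have h1 := h _ (inv_mem_V_of_notMem_m hc) w hw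
  have hw0 : w ≠ 0 := by rintro rfl; simp at hc
  rw [mul_inv, inv_inv, inv_mul_cancel_right₀ hw0] at h1
  exact hz h1

/-- Modules over the localization at `q` regarded as modules over the branch of `q`. -/
def Mod.ofStab (B : Mod K p (V K q)) : Mod K p (T K q) :=
  ⟨B.1, B.2.1, B.2.2.1, B.2.2.2.1, fun t ht => B.2.2.2.2 t (T_subset_V q ht)⟩

theorem Mod.stab (hpq : p ≤ q) (B : Mod K p (V K q)) : Stab q B.1 := fun v hv y hy =>
  B.2.2.2.2 v hv (V_anti hpq hv) y hy

/-- A stable module as a module over the localization at `q`. -/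
def Mod.restrict (C : Mod K p R) (h : Stab q C.1) : Mod K p (V K q) :=
  ⟨C.1, C.2.1, C.2.2.1, C.2.2.2.1, fun t ht _ => h t ht⟩

/-- The maximal ideal of the localization at `q`, as a module in between. -/
def Mod.ofMax (hpq : p < q) : Mod K p (V K q) :=
  ⟨m K q, m_mono hpq.le, by
    obtain ⟨a, haq, hap⟩ := exists_mem_not_mem_of_lt hpq
    exact ⟨algebraMap D K a, algebraMap_mem_m.2 haq, by rwa [algebraMap_mem_m]⟩,
    m_le_V.trans (V_anti hpq.le), fun _ ht _ _ hy => mul_mem_m ht hy⟩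

/-- Modules above `q` regarded as modules above `p` over the branch of `q`. -/
def Mod.lift (hpq : p ≤ q) (J : Mod K q ∅) : Mod K p (T K q) :=
  ⟨J.1, (m_mono hpq).trans J.2.1, by
    obtain ⟨y, hy, hy'⟩ := J.2.2.1
    exact ⟨y, hy, fun h => hy' (m_mono hpq h)⟩, J.2.2.2.1.trans (V_anti hpq),
    fun t ht _ y hy => by
      refine mem_of_locally fun M => ?_
      by_cases hM : q ≤ M.toPrimeSpectrum
      · obtain ⟨u, hu, a, ha⟩ := exists_algebraMap_mul (ht M hM)
        refine ⟨u, hu, ?_⟩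
        rw [Algebra.smul_def, ← mul_assoc, ha, ← Algebra.smul_def]
        exact J.1.smul_mem a hy
      · obtain ⟨d, hd, hdM⟩ := SetLike.not_le_iff_exists.1
          (fun hle => hM hle : ¬ q.asIdeal ≤ M.asIdeal)
        refine ⟨d, hdM, J.2.1 ?_⟩
        rw [Algebra.smul_def, mul_comm]
        exact mul_mem_m (mul_mem_V (T_subset_V q ht) (J.2.2.2.1 hy)) (algebraMap_mem_m.2 hd)⟩

theorem Mod.act_lift (hpq : p ≤ q) (x : Un K q) (J : Mod K q ∅) :
    act p _ (x.ofLE hpq) (J.lift hpq) = (act q ∅ x J).lift hpq := rfl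

/-- A module over the branch of `q` is a module over the localization at `q`, or a multiple of
a module between the maximal ideal and the localization at `q`. -/
theorem Mod.exists_eq_act_lift (hpq : p ≤ q) (C : Mod K p (T K q)) (hC : ¬ Stab q C.1) :
    ∃ (x : Un K p) (J : Mod K q ∅), C = act p _ x (J.lift hpq) := by
  unfold Stab at hC
  push Not at hC
  obtain ⟨v, hv, y, hy, hvy⟩ := hC
  have hyp : y ∉ m K p := fun h => hvy (C.2.1 (mul_mem_m (V_anti hpq hv) h))
  have hy0 := ne_zero_of_notMem hyp
  have hvy0 := ne_zero_of_notMem hvy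
  let x : Un K p := ⟨y, C.2.2.2.1 hy, hyp⟩
  refine ⟨x, ⟨y⁻¹ • C.1, fun t ht => ?_, ⟨1, ?_, one_notMem_m⟩, fun w hw => ?_, fun _ h => h.elim⟩,
    Subtype.ext (smul_inv_smul₀ hy0 C.1).symm⟩
  · rw [mem_smul_iff (inv_ne_zero hy0), inv_inv, mul_comm]
    exact C.T_mul_mem hpq (m_subset_T ht) hy
  · rwa [mem_smul_iff (inv_ne_zero hy0), inv_inv, mul_one]
  · rw [mem_smul_iff (inv_ne_zero hy0), inv_inv] at hw
    have h1 : y * w / (v * y) ∈ V K q := by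
      by_contra hc
      have h1 := C.T_mul_mem hpq (m_subset_T (inv_mem_m hc)) hw
      have h0 : y * w ≠ 0 := fun h => hc (by simp [h])
      rw [inv_div, div_mul_cancel₀ _ h0] at h1
      exact hvy h1
    have h2 := mul_mem_V hv h1
    have hv0 : v ≠ 0 := left_ne_zero_of_mul hvy0
    have : v * (y * w / (v * y)) = w := by field_simp
    rwa [this] at h2

/-- Closed modules of the operator on the branch induced by an operator at `q`. -/
def lowerFamily (hpq : p ≤ q) (n : NSys K q) : Set (Mod K p (T K q)) :=
  {C | Stab q C.1 ∨ ∃ (x : Un K p) (J : Mod K q ∅), n.1 J = J ∧ C = act p _ x (J.lift hpq)}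

/-- Closed modules of the operator on the branch induced by an operator on modules over the
localization at `q`. -/
def upperFamily (h : HSys K p q) : Set (Mod K p (T K q)) :=
  {C | ∃ hC : Stab q C.1, h.1 (C.restrict hC) = C.restrict hC}

/-- The operator on the branch induced by an operator at `q`. -/
def Sys.lower (hpq : p ≤ q) (n : NSys K q) : ESys K p q :=
  ofFamily (lowerFamily hpq n) <| by
    rintro x C (hC | ⟨y, J, hJ, rfl⟩)
    · exact Or.inl (hC.smul x.ne_zero)
    · exact Or.inr ⟨x * y, J, hJ, act_act _ _ _⟩

/-- The operator on the branch induced by an operator on modules over the localization. -/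
def Sys.upper (h : HSys K p q) : ESys K p q :=
  ofFamily (upperFamily h) <| by
    rintro x C ⟨hC, hh⟩
    refine ⟨hC.smul x.ne_zero, ?_⟩
    have := h.2.2.2.2 x (C.restrict hC)
    rw [hh] at this
    exact this

theorem Sys.lower_apply_lift (hpq : p ≤ q) (n : NSys K q) (J : Mod K q ∅) :
    (lower hpq n).1 (J.lift hpq) = (n.1 J).lift hpq := by
  refine le_antisymm ?_ ?_
  · exact ofFamily_apply_le (Or.inr ⟨1, n.1 J, n.2.2.2.1 J, (act_one _).symm⟩)
      (n.2.1 J : J.1 ≤ (n.1 J).1)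
  · refine le_ofFamily_apply ?_
    obtain ⟨y, hy, hy'⟩ := J.2.2.1
    rintro C (hC | ⟨x, J', hJ', rfl⟩) hJC
    · exact (n.1 J).2.2.2.1.trans (hC.V_le (hJC hy) hy')
    · by_cases hxV : (x : K) ∈ V K q
      · have hxm : (x : K) ∉ m K q := fun hx => hy' <| by
          have h1 : y ∈ (x : K) • J'.1 := hJC hy
          rw [mem_smul_iff x.ne_zero] at h1
          have := mul_mem_m (J'.2.2.2.1 h1) hx
          rwa [mul_comm, mul_inv_cancel_left₀ x.ne_zero] at this
        have h1 : J ≤ act q ∅ (⟨x.1, hxV, hxm⟩ : Un K q) J' := hJC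
        have h2 := n.2.2.1 h1
        rw [n.2.2.2.2, hJ'] at h2
        exact h2
      · intro w hw
        have hwV := (n.1 J).2.2.2.1 hw
        change w ∈ (x : K) • J'.1
        rw [mem_smul_iff x.ne_zero, mul_comm]
        exact J'.2.1 (mul_mem_m hwV (inv_mem_m hxV))

theorem Sys.upper_apply_ofStab (hpq : p ≤ q) (h : HSys K p q) (B : Mod K p (V K q)) :
    (upper h).1 B.ofStab = (h.1 B).ofStab := by
  refine le_antisymm ?_ ?_
  · exact ofFamily_apply_le ⟨(h.1 B).stab hpq, h.2.2.2.1 B⟩ (h.2.1 B : B.1 ≤ (h.1 B).1)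
  · refine le_ofFamily_apply ?_
    rintro C ⟨hC, hh⟩ hBC
    have h1 : B ≤ C.restrict hC := hBC
    have h2 := h.2.2.1 h1
    rw [hh] at h2
    exact h2

theorem Sys.lower_le_lower (hpq : p ≤ q) {n n' : NSys K q} : lower hpq n ≤ lower hpq n' ↔ n ≤ n' := by
  refine ⟨fun h J => ?_, fun h => le_ofFamily fun C hC => ofFamily_apply_eq ?_⟩
  · have := h (J.lift hpq)
    rwa [lower_apply_lift, lower_apply_lift] at this
  · rcases hC with hC | ⟨x, J', hJ', rfl⟩
    · exact Or.inl hC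
    · exact Or.inr ⟨x, J', apply_eq_of_le h hJ', rfl⟩

theorem Sys.upper_le_upper (hpq : p ≤ q) {h h' : HSys K p q} : upper h ≤ upper h' ↔ h ≤ h' := by
  refine ⟨fun hh B => ?_, fun hh => le_ofFamily ?_⟩
  · have := hh B.ofStab
    rwa [upper_apply_ofStab hpq, upper_apply_ofStab hpq] at this
  · rintro C ⟨hC, hC'⟩
    exact ofFamily_apply_eq ⟨hC, apply_eq_of_le hh hC'⟩

theorem Sys.lower_le_upper (hpq : p ≤ q) (n : NSys K q) (h : HSys K p q) :
    lower hpq n ≤ upper h := le_ofFamily fun _ hC => ofFamily_apply_eq (Or.inl hC.1)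

theorem Sys.eq_bot_of_upper_le_lower (hpq : p ≤ q) {n : NSys K q} {h : HSys K p q}
    (hle : upper h ≤ lower hpq n) : h = ⊥ := by
  refine le_bot_iff.1 fun B => ?_
  have h1 := hle B.ofStab
  rw [upper_apply_ofStab hpq] at h1
  exact h1.trans (ofFamily_apply_eq (Or.inl (B.stab hpq))).le

theorem Mod.stab_lift_top (hpq : p ≤ q) : Stab q ((⊤ : Mod K q ∅).lift hpq).1 :=
  fun _ hv _ hy => mul_mem_V hv hy

theorem Mod.stab_act {x : Un K p} {C : Mod K p R} (h : Stab q C.1) : Stab q (act p R x C).1 :=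
  h.smul x.ne_zero

theorem Mod.coe_eq_of_eq {A B : Mod K p R} {I J : Submodule D K} (h : A = B) (hA : A.1 = I)
    (hB : B.1 = J) : I = J := by rw [← hA, ← hB, h]

theorem Mod.lift_injective (hpq : p ≤ q) : Function.Injective (Mod.lift (K := K) hpq) :=
  fun _ _ h => Subtype.ext (Mod.coe_eq_of_eq h rfl rfl)

theorem Sys.apply_eq_of_stab (hpq : p < q) {c : ESys K p q}
    (hc : c.1 (Mod.ofMax hpq).ofStab = (Mod.ofMax hpq).ofStab) {C : Mod K p (T K q)}
    (hC : Stab q C.1) : c.1 C = C := by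
  refine le_antisymm (fun z hz => ?_) (c.2.1 C)
  by_contra hzC
  let x : Un K p := ⟨z, (c.1 C).2.2.2.1 hz, fun h => hzC (C.2.1 h)⟩
  have h1 : C ≤ act p _ x (Mod.ofMax hpq).ofStab := hC.le_smul_m hzC
  have h2 := c.2.2.1 h1
  rw [c.2.2.2.2, hc] at h2
  have h3 : z ∈ z • m K q := h2 hz
  rw [mem_smul_iff x.ne_zero, inv_mul_cancel₀ x.ne_zero] at h3
  exact one_notMem_m h3

theorem Sys.exists_eq_lower (hpq : p < q) {c : ESys K p q}
    (hc : c.1 (Mod.ofMax hpq).ofStab = (Mod.ofMax hpq).ofStab) :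
    ∃ n : NSys K q, c = lower hpq.le n := by
  have hlift : ∀ J : Mod K q ∅, ∃ J' : Mod K q ∅, c.1 (J.lift hpq.le) = J'.lift hpq.le := by
    intro J
    have hle : J.lift hpq.le ≤ (⊤ : Mod K q ∅).lift hpq.le := J.2.2.2.1
    have h1 := c.2.2.1 hle
    rw [apply_eq_of_stab hpq hc (Mod.stab_lift_top hpq.le)] at h1
    obtain ⟨y, hy, hy'⟩ := J.2.2.1
    exact ⟨⟨(c.1 (J.lift hpq.le)).1, J.2.1.trans (c.2.1 (J.lift hpq.le)),
      ⟨y, c.2.1 (J.lift hpq.le) hy, hy'⟩, h1, fun _ h => h.elim⟩, rfl⟩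
  choose n hn using hlift
  have hinj := Mod.lift_injective (K := K) hpq.le
  let N : NSys K q := ⟨n, fun J => ?_, fun J J' h => ?_, fun J => hinj ?_, fun x J => hinj ?_⟩
  · refine ⟨N, le_antisymm (le_ofFamily ?_) (ofFamily_le fun J => ?_)⟩
    · rintro C (hC | ⟨x, J, hJ, rfl⟩)
      · exact apply_eq_of_stab hpq hc hC
      · rw [c.2.2.2.2, hn, show n J = J from hJ]
    · by_cases hJ : Stab q (c.1 J).1
      · exact Or.inl hJ
      · obtain ⟨x, J', hJ'⟩ := Mod.exists_eq_act_lift hpq.le _ hJ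
        refine Or.inr ⟨x, J', hinj ?_, hJ'⟩
        have h1 := c.2.2.2.1 J
        rw [hJ', c.2.2.2.2] at h1
        exact (hn J').symm.trans (act_injective x h1)
  · have := c.2.1 (J.lift hpq.le)
    rw [hn] at this
    exact this
  · have h1 : J.lift hpq.le ≤ J'.lift hpq.le := h
    have := c.2.2.1 h1
    rw [hn, hn] at this
    exact this
  · rw [← hn, ← hn, c.2.2.2.1]
  · rw [← hn, ← Mod.act_lift, c.2.2.2.2, hn, Mod.act_lift]

theorem Sys.stab_apply (hpq : p < q) {c : ESys K p q}
    (hc : c.1 (Mod.ofMax hpq).ofStab ≠ (Mod.ofMax hpq).ofStab) (J : Mod K p (T K q)) :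
    Stab q (c.1 J).1 := by
  by_contra hJ
  obtain ⟨x, J', hJ'⟩ := Mod.exists_eq_act_lift hpq.le _ hJ
  have hcl : c.1 (J'.lift hpq.le) = J'.lift hpq.le := by
    have h1 := c.2.2.2.1 J
    rw [hJ', c.2.2.2.2] at h1
    exact act_injective x h1
  have hne : J' ≠ ⊤ := by
    rintro rfl
    rw [hJ'] at hJ
    exact hJ (Mod.stab_act (Mod.stab_lift_top hpq.le))
  obtain ⟨z, hzV, hzJ⟩ := Mod.exists_of_ne_top hne
  have key : ∀ u : Un K q, c.1 (Mod.ofMax hpq).ofStab ≤ (act q ∅ u J').lift hpq.le := by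
    intro u
    have h1 : (Mod.ofMax hpq).ofStab ≤ (act q ∅ u J').lift hpq.le := (act q ∅ u J').2.1
    have h2 := c.2.2.1 h1
    rwa [← Mod.act_lift, c.2.2.2.2, hcl] at h2
  refine hc (le_antisymm (fun y hy => ?_) (c.2.1 _))
  by_contra hym
  let z' : Un K q := ⟨z, hzV, fun h => hzJ (J'.2.1 h)⟩
  let y' : Un K q := ⟨y, J'.2.2.2.1 (by
    have h1 := key 1
    rw [act_one] at h1
    exact h1 hy), hym⟩
  have h1 : y ∈ ((y' * z'⁻¹ : Un K q) : K) • J'.1 := key (y' * z'⁻¹) hy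
  rw [mem_smul_iff (Un.ne_zero _)] at h1
  have h2 : ((y' * z'⁻¹ : Un K q) : K)⁻¹ * y = z := by
    have hy0 : y ≠ 0 := y'.ne_zero
    change (y * z⁻¹)⁻¹ * y = z
    field_simp
  rw [h2] at h1
  exact hzJ h1

theorem Sys.exists_eq_upper (hpq : p < q) {c : ESys K p q}
    (hc : c.1 (Mod.ofMax hpq).ofStab ≠ (Mod.ofMax hpq).ofStab) :
    ∃ h : HSys K p q, h ≠ ⊥ ∧ c = upper h := by
  have hst := stab_apply hpq hc
  let h : HSys K p q := ⟨fun B => (c.1 B.ofStab).restrict (hst _), fun B => c.2.1 B.ofStab,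
    fun B B' hB => c.2.2.1 (show B.ofStab ≤ B'.ofStab from hB),
    fun B => Subtype.ext (Mod.coe_eq_of_eq (c.2.2.2.1 B.ofStab) rfl rfl),
    fun x B => Subtype.ext (Mod.coe_eq_of_eq (c.2.2.2.2 x B.ofStab) rfl rfl)⟩
  refine ⟨h, fun hb => hc ?_, le_antisymm (le_ofFamily ?_) (ofFamily_le fun J => ?_)⟩
  · have := congrArg (fun e : HSys K p q => (e.1 (Mod.ofMax hpq)).1) hb
    exact Subtype.ext this
  · rintro C ⟨hC, hC'⟩
    exact Subtype.ext (Mod.coe_eq_of_eq hC' rfl rfl)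
  · exact ⟨hst J, Subtype.ext (Mod.coe_eq_of_eq (c.2.2.2.1 J) rfl rfl)⟩

theorem nonempty_ESys_orderIso (hpq : p < q) :
    Nonempty (NSys K q ⊕ₗ {h : HSys K p q // h ≠ ⊥} ≃o ESys K p q) := by
  let f : NSys K q ⊕ₗ {h : HSys K p q // h ≠ ⊥} → ESys K p q := fun s =>
    Sum.elim (Sys.lower hpq.le) (fun h => Sys.upper h.1) (ofLex s)
  have hf : ∀ a b, f a ≤ f b ↔ a ≤ b := by
    intro a b
    induction a using Lex.rec with | _ a
    induction b using Lex.rec with | _ b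
    rcases a with n | h <;> rcases b with n' | h'
    · rw [Sum.Lex.inl_le_inl_iff]
      exact Sys.lower_le_lower hpq.le
    · exact iff_of_true (Sys.lower_le_upper hpq.le _ _) (Sum.Lex.inl_le_inr _ _)
    · exact iff_of_false (fun hle => h.2 (Sys.eq_bot_of_upper_le_lower hpq.le hle))
        Sum.Lex.not_inr_le_inl
    · rw [Sum.Lex.inr_le_inr_iff]
      exact Sys.upper_le_upper hpq.le
  refine ⟨RelIso.ofSurjective (OrderEmbedding.ofMapLEIff f hf) fun c => ?_⟩
  by_cases hc : c.1 (Mod.ofMax hpq).ofStab = (Mod.ofMax hpq).ofStab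
  · obtain ⟨n, rfl⟩ := Sys.exists_eq_lower hpq hc
    exact ⟨toLex (Sum.inl n), rfl⟩
  · obtain ⟨h, hh, rfl⟩ := Sys.exists_eq_upper hpq hc
    exact ⟨toLex (Sum.inr ⟨h, hh⟩), rfl⟩

end BranchOperators

section StarOperations

/-- Nonzero fractional ideals. -/
abbrev NZFrac (A : Type*) [CommRing A] :=
  {I : FractionalIdeal (nonZeroDivisors A) (FractionRing A) // I ≠ 0}

/-- Multiplication of a nonzero fractional ideal by a nonzero element. -/
def fracAct (A : Type*) [CommRing A] [IsDomain A] (x : {x : FractionRing A // x ≠ 0})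
    (I : NZFrac A) : NZFrac A :=
  ⟨FractionalIdeal.spanSingleton _ x.1 * I.1,
    fun h => I.2 (by
      have h1 := congrArg (FractionalIdeal.spanSingleton _ x.1⁻¹ * ·) h
      simpa [← mul_assoc, FractionalIdeal.spanSingleton_mul_spanSingleton, x.2] using h1)⟩

theorem exists_ne_zero_mem {A : Type*} [CommRing A] (I : NZFrac A) : ∃ y ∈ I.1, y ≠ 0 := by
  by_contra! h
  exact I.2 (FractionalIdeal.eq_zero_iff.2 h)

theorem AFracStar.apply_zero {A : Type*} [CommRing A] [IsDomain A]
    (hA : ¬ Function.Surjective (algebraMap A (FractionRing A))) (s : AFracStar A) :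
    s.toFun 0 = 0 := by
  by_contra h
  obtain ⟨y, hy, hy0⟩ := exists_ne_zero_mem ⟨_, h⟩
  have hall : ∀ x : FractionRing A, x ≠ 0 → x ∈ s.toFun 0 := by
    intro x hx
    have h1 := s.smul' (x * y⁻¹) (mul_ne_zero hx (inv_ne_zero hy0)) 0
    rw [mul_zero] at h1
    rw [h1, FractionalIdeal.mem_singleton_mul]
    exact ⟨y, hy, by rw [inv_mul_cancel_right₀ hy0]⟩
  obtain ⟨a, ha, hI⟩ := (s.toFun 0).isFractional
  have ha0 : algebraMap A (FractionRing A) a ≠ 0 := by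
    simpa using nonZeroDivisors.ne_zero ha
  refine hA fun z => ?_
  by_cases hz : z = 0
  · exact ⟨0, by rw [hz, map_zero]⟩
  · obtain ⟨c, hc⟩ := hI ((algebraMap A (FractionRing A) a)⁻¹ * z)
      (hall _ (mul_ne_zero (inv_ne_zero ha0) hz))
    exact ⟨c, by rw [hc, Algebra.smul_def, mul_inv_cancel_left₀ ha0]⟩

open Classical in
/-- Fractional star operations are determined by their action on nonzero fractional ideals. -/
def AFracStar.equivEqClo {A : Type*} [CommRing A] [IsDomain A]
    (hA : ¬ Function.Surjective (algebraMap A (FractionRing A))) :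
    AFracStar A ≃ EqClo (fracAct A) where
  toFun s := ⟨fun I => ⟨s.toFun I.1, fun h => I.2
      (le_zero_iff.1 ((s.le_star' I.1).trans h.le))⟩,
    fun I => s.le_star' I.1, fun I J h => s.mono' h, fun I => Subtype.ext (s.idem' I.1),
    fun x I => Subtype.ext (s.smul' x.1 x.2 I.1)⟩
  invFun c :=
    { toFun := fun I => if h : I = 0 then 0 else (c.1 ⟨I, h⟩).1
      le_star' := fun I => by
        by_cases h : I = 0
        · simp [h]
        · simp only [h, dite_false]
          exact c.2.1 ⟨I, h⟩
      mono' := fun I J hIJ => by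
        by_cases h : I = 0
        · simp [h]
        · have hJ : J ≠ 0 := by
            rintro rfl
            exact h (le_zero_iff.1 hIJ)
          simpa [h, hJ] using c.2.2.1 (show (⟨I, h⟩ : NZFrac A) ≤ ⟨J, hJ⟩ from hIJ)
      idem' := fun I => by
        by_cases h : I = 0
        · simp [h]
        · simp only [h, dite_false, (c.1 ⟨I, h⟩).2]
          exact congrArg Subtype.val (c.2.2.2.1 ⟨I, h⟩)
      smul' := fun x hx I => by
        by_cases h : I = 0
        · simp [h]
        · have h1 := (fracAct A ⟨x, hx⟩ ⟨I, h⟩).2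
          have h2 := congrArg Subtype.val (c.2.2.2.2 ⟨x, hx⟩ ⟨I, h⟩)
          simp only [h, dite_false]
          exact (dif_neg h1).trans h2 }
  left_inv s := AFracStar.ext' <| funext fun I => by
    by_cases h : I = 0
    · simp [h, apply_zero hA]
    · simp [h]
  right_inv c := by
    refine EqClo.ext_fun fun I => Subtype.ext ?_
    simp [I.2]

end StarOperations

section Branch

variable {D : Type*} [CommRing D] [IsDomain D]
variable {K : Type*} [Field K] [Algebra D K] [IsFractionRing D K] [Fact (IsPrufer D K)]
variable {p q : PrimeSpectrum D}

theorem Stab.le_or_le {J J' : Submodule D K} (h : Stab q J) (h' : Stab q J') :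
    J ≤ J' ∨ J' ≤ J := by
  refine or_iff_not_imp_left.2 fun hn => ?_
  obtain ⟨z, hz, hz'⟩ := SetLike.not_le_iff_exists.1 hn
  intro w hw
  have h1 := h'.le_smul_m hz' hw
  have hz0 := ne_zero_of_notMem hz'
  rw [mem_smul_iff hz0] at h1
  have := h _ (m_le_V h1) z hz
  rwa [mul_comm, mul_inv_cancel_left₀ hz0] at this

theorem HSys.le_or_le (hpq : p ≤ q) (c c' : HSys K p q) : c ≤ c' ∨ c' ≤ c := by
  have key : ∀ {c c' : HSys K p q}, ¬ c ≤ c' →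
      ∃ B : Mod K p (V K q), c'.1 B = B ∧ (1 : K) ∉ B.1 ∧ (1 : K) ∈ (c.1 B).1 := by
    intro c c' h
    rw [EqClo.le_iff] at h
    push Not at h
    obtain ⟨J, hJ⟩ := h
    have h1 : ¬ c.1 (c'.1 J) ≤ c'.1 J := fun h => hJ ((c.2.2.1 (c'.2.1 J)).trans h)
    obtain ⟨z, hz, hz'⟩ := SetLike.not_le_iff_exists.1
      (show ¬ (c.1 (c'.1 J)).1 ≤ (c'.1 J).1 from h1)
    let x : Un K p := ⟨z, (c.1 (c'.1 J)).2.2.2.1 hz, fun h => hz' ((c'.1 J).2.1 h)⟩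
    refine ⟨act p _ x⁻¹ (c'.1 J), by rw [c'.2.2.2.2, c'.2.2.2.1], ?_, ?_⟩
    · rw [coe_act, mem_smul_iff (x⁻¹).ne_zero, Un.coe_inv, inv_inv, mul_one]
      exact hz'
    · rw [c.2.2.2.2, coe_act, mem_smul_iff (x⁻¹).ne_zero, Un.coe_inv, inv_inv, mul_one]
      exact hz
  by_contra! hn
  obtain ⟨B, hB, hB1, hB2⟩ := key hn.1
  obtain ⟨B', hB', hB1', hB2'⟩ := key hn.2
  rcases (B.stab hpq).le_or_le (B'.stab hpq) with h | h
  · have h1 := c.2.2.1 (show B ≤ B' from h)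
    rw [hB'] at h1
    exact hB1' (h1 hB2)
  · have h1 := c'.2.2.1 (show B' ≤ B from h)
    rw [hB] at h1
    exact hB1 (h1 hB2')

/-- The operators other than the constant one act on the proper modules. -/
abbrev PMod (K : Type*) [Field K] [Algebra D K] [IsFractionRing D K] (p q : PrimeSpectrum D) :=
  {J : Mod K p (V K q : Set K) // J ≠ ⊤}

/-- Multiplication of proper modules by units. -/
def pAct (p q : PrimeSpectrum D) (x : Un K p) (J : PMod K p q) : PMod K p q :=
  ⟨act p _ x J.1, fun h => J.2 (act_injective x (h.trans (act_top x).symm))⟩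

end Branch

section Branch

variable {D : Type*} [CommRing D] [IsDomain D] [Finite (MaximalSpectrum D)] [Finite (hiSpec D)]
variable {K : Type*} [Field K] [Algebra D K] [IsFractionRing D K] [Fact (IsPrufer D K)]
variable {p q : PrimeSpectrum D}

open Classical in
/-- The operators other than the constant one, as operators on proper modules. -/
def HSys.equivEqClo (hpq : p < q) (hV : ∃ J : Mod K p (V K q : Set K), J ≠ ⊤) :
    {h : HSys K p q // h ≠ ⊤} ≃ EqClo (pAct (K := K) p q) where
  toFun h := ⟨fun J => ⟨h.1.1 J.1, fun ht => h.2 <|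
      EqClo.eq_top_of_apply_eq_top act_top (exists_act_le hpq m_le_V) h.1 J.2 ht⟩,
    fun J => h.1.2.1 J.1, fun J J' hJ => h.1.2.2.1 hJ, fun J => Subtype.ext (h.1.2.2.2.1 J.1),
    fun x J => Subtype.ext (h.1.2.2.2.2 x J.1)⟩
  invFun c := ⟨⟨fun J => if h : J = ⊤ then ⊤ else (c.1 ⟨J, h⟩).1, fun J => by
      by_cases h : J = ⊤
      · simp [h]
      · simp only [h, dite_false]
        exact c.2.1 ⟨J, h⟩, fun J J' hJ => by
      by_cases h : J' = ⊤
      · simp [h]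
      · have hJ0 : J ≠ ⊤ := by
          rintro rfl
          exact h (top_le_iff.1 hJ)
        simpa [h, hJ0] using c.2.2.1 (show (⟨J, hJ0⟩ : PMod K p q) ≤ ⟨J', h⟩ from hJ), fun J => by
      by_cases h : J = ⊤
      · simp [h]
      · simp only [h, dite_false, (c.1 ⟨J, h⟩).2]
        exact congrArg Subtype.val (c.2.2.2.1 ⟨J, h⟩), fun x J => by
      by_cases h : J = ⊤
      · simp [h, act_top]
      · have h1 := (pAct p q x ⟨J, h⟩).2
        have h2 := congrArg Subtype.val (c.2.2.2.2 x ⟨J, h⟩)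
        simp only [h, dite_false]
        exact (dif_neg h1).trans h2⟩, fun ht => by
      obtain ⟨J, hJ⟩ := hV
      have h1 := congrArg (fun e : HSys K p q => e.1 J) ht
      rw [EqClo.top_apply act_top] at h1
      simp only [hJ, dite_false] at h1
      exact (c.1 ⟨J, hJ⟩).2 h1⟩
  left_inv h := Subtype.ext <| EqClo.ext_fun fun J => by
    by_cases hJ : J = ⊤
    · simp [hJ, EqClo.apply_top]
    · simp [hJ]
  right_inv c := by
    refine EqClo.ext_fun fun J => Subtype.ext ?_
    simp [J.2]

end Branch

section Transport

variable {D : Type*} [CommRing D] [IsDomain D]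
variable {K : Type*} [Field K] [Algebra D K] [IsFractionRing D K] [Fact (IsPrufer D K)]
variable {p q : PrimeSpectrum D} {A : Type*} [CommRing A] [IsDomain A]

/-- A ring homomorphism identifying the residue field of the localization at `p` with the
fraction field of `A`, so that the localization at `q` is the inverse image of `A`. -/
structure IsResidue (p q : PrimeSpectrum D)
    (ρ : locAt D K p.asIdeal p.isPrime →+* FractionRing A) : Prop where
  surjective : Function.Surjective ρ
  eq_zero_iff : ∀ x, ρ x = 0 ↔ (x : K) ∈ m K p
  integer_iff : ∀ x, (∃ a, algebraMap A (FractionRing A) a = ρ x) ↔ (x : K) ∈ V K q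

variable {ρ : locAt D K p.asIdeal p.isPrime →+* FractionRing A}

namespace IsResidue

theorem exists_unit (hρ : IsResidue p q ρ) {z : FractionRing A} (hz : z ≠ 0) :
    ∃ x : Un K p, ρ ⟨x, x.2.1⟩ = z := by
  obtain ⟨x, rfl⟩ := hρ.surjective z
  exact ⟨⟨x, x.2, fun h => hz ((hρ.eq_zero_iff x).2 h)⟩, rfl⟩

theorem map_unit_ne_zero (hρ : IsResidue p q ρ) (x : Un K p) : ρ ⟨x, x.2.1⟩ ≠ 0 :=
  fun h => x.2.2 ((hρ.eq_zero_iff _).1 h)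

theorem not_surjective (hρ : IsResidue p q ρ) (hpq : ¬ V K p ≤ V K q) :
    ¬ Function.Surjective (algebraMap A (FractionRing A)) := by
  obtain ⟨x, hx, hx'⟩ := SetLike.not_le_iff_exists.1 hpq
  exact fun h => hx' ((hρ.integer_iff ⟨x, hx⟩).1 (h _))

/-- The inverse image of a nonzero fractional ideal. -/
def comap (hρ : IsResidue p q ρ) (hpq : ¬ V K p ≤ V K q) (I : NZFrac A) :
    PMod K p q :=
  ⟨⟨{ carrier := {x | ∃ h : x ∈ V K p, ρ ⟨x, h⟩ ∈ I.1}
      zero_mem' := ⟨zero_mem _, by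
        rw [(hρ.eq_zero_iff _).2 (zero_mem _)]; exact I.1.zero_mem⟩
      add_mem' := by
        rintro x y ⟨hx, hx'⟩ ⟨hy, hy'⟩
        refine ⟨add_mem hx hy, ?_⟩
        have : ρ ⟨x + y, add_mem hx hy⟩ = ρ ⟨x, hx⟩ + ρ ⟨y, hy⟩ := by rw [← map_add]; rfl
        rw [this]
        exact (I.1 : Submodule A (FractionRing A)).add_mem hx' hy'
      smul_mem' := by
        rintro d x ⟨hx, hx'⟩
        refine ⟨(V K p).smul_mem d hx, ?_⟩
        obtain ⟨a, ha⟩ := (hρ.integer_iff ⟨algebraMap D K d, algebraMap_mem_V d⟩).2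
          (algebraMap_mem_V d)
        have : ρ ⟨d • x, (V K p).smul_mem d hx⟩ = a • ρ ⟨x, hx⟩ := by
          change ρ (d • ⟨x, hx⟩) = _
          rw [Algebra.smul_def, Algebra.smul_def, map_mul, ha]
          rfl
        rw [this]
        exact (I.1 : Submodule A (FractionRing A)).smul_mem a hx' },
    fun x hx => ⟨m_le_V hx, by
      rw [(hρ.eq_zero_iff ⟨x, m_le_V hx⟩).2 hx]; exact I.1.zero_mem⟩, by
      obtain ⟨y, hy, hy0⟩ := exists_ne_zero_mem I
      obtain ⟨x, rfl⟩ := hρ.exists_unit hy0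
      exact ⟨x, ⟨x.2.1, hy⟩, x.2.2⟩,
    fun x hx => hx.1, by
      rintro t ht ht' y ⟨hy, hy'⟩
      refine ⟨mul_mem_V ht' hy, ?_⟩
      obtain ⟨a, ha⟩ := (hρ.integer_iff ⟨t, ht'⟩).2 ht
      have : ρ ⟨t * y, mul_mem_V ht' hy⟩ = a • ρ ⟨y, hy⟩ := by
        rw [Algebra.smul_def, ha, ← map_mul]; rfl
      rw [this]
      exact (I.1 : Submodule A (FractionRing A)).smul_mem a hy'⟩, by
    intro htop
    refine hρ.not_surjective hpq fun z => ?_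
    obtain ⟨a, ha, hI⟩ := I.1.isFractional
    have ha0 : algebraMap A (FractionRing A) a ≠ 0 := by
      simpa using nonZeroDivisors.ne_zero ha
    obtain ⟨x, hx⟩ := hρ.surjective ((algebraMap A (FractionRing A) a)⁻¹ * z)
    have hx1 : (x : K) ∈ V K p := x.2
    rw [← Mod.coe_top (K := K) (p := p) (R := V K q), ← htop] at hx1
    obtain ⟨_, hx2⟩ := hx1
    obtain ⟨c, hc⟩ := hI _ hx2
    refine ⟨c, ?_⟩
    rw [hc, Algebra.smul_def]
    change _ * ρ x = z
    rw [hx, mul_inv_cancel_left₀ ha0]⟩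

variable {hρ : IsResidue p q ρ} {hpq : ¬ V K p ≤ V K q}

theorem mem_comap {I : NZFrac A} (x : locAt D K p.asIdeal p.isPrime) :
    (x : K) ∈ (hρ.comap hpq I).1.1 ↔ ρ x ∈ I.1 :=
  ⟨fun h => h.2, fun h => ⟨x.2, h⟩⟩

theorem comap_le_comap {I I' : NZFrac A} :
    hρ.comap hpq I ≤ hρ.comap hpq I' ↔ I ≤ I' := by
  refine ⟨fun h z hz => ?_, fun h x hx => ⟨hx.1, h hx.2⟩⟩
  obtain ⟨x, rfl⟩ := hρ.surjective z
  exact (mem_comap x).1 (h ((mem_comap x).2 hz))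

theorem comap_surjective (hle : p ≤ q) : Function.Surjective (hρ.comap hpq) := by
  rintro ⟨J, hJ⟩
  obtain ⟨z, hzV, hzJ⟩ := Mod.exists_of_ne_top hJ
  let I : Submodule A (FractionRing A) :=
    { carrier := {y | ∃ x, ρ x = y ∧ (x : K) ∈ J.1}
      zero_mem' := ⟨0, map_zero _, J.1.zero_mem⟩
      add_mem' := by
        rintro _ _ ⟨x, rfl, hx⟩ ⟨y, rfl, hy⟩
        exact ⟨x + y, map_add _ _ _, J.1.add_mem hx hy⟩
      smul_mem' := by
        rintro a _ ⟨x, rfl, hx⟩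
        obtain ⟨t, ht⟩ := hρ.surjective (algebraMap A _ a)
        refine ⟨t * x, by rw [map_mul, ht, Algebra.smul_def], ?_⟩
        exact J.2.2.2.2 t ((hρ.integer_iff t).1 ⟨a, ht.symm⟩) t.2 _ hx }
  have hI : ∀ x, ρ x ∈ I ↔ (x : K) ∈ J.1 := by
    refine fun x => ⟨?_, fun h => ⟨x, rfl, h⟩⟩
    rintro ⟨y, hy, hyJ⟩
    have h1 : ((x - y : locAt D K p.asIdeal p.isPrime) : K) ∈ m K p :=
      (hρ.eq_zero_iff _).1 (by rw [map_sub, hy, sub_self])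
    have h2 := J.1.add_mem (J.2.1 h1) hyJ
    simpa using h2
  have hfrac : IsFractional (nonZeroDivisors A) I := by
    let u : Un K p := ⟨z, hzV, fun h => hzJ (J.2.1 h)⟩
    obtain ⟨⟨a, b⟩, hab⟩ := IsLocalization.surj (nonZeroDivisors A) (ρ ⟨(u⁻¹ : Un K p), (u⁻¹).2.1⟩)
    have hb0 : algebraMap A (FractionRing A) b ≠ 0 := by simp
    have hu0 := hρ.map_unit_ne_zero u⁻¹
    refine ⟨a, mem_nonZeroDivisors_of_ne_zero ?_, ?_⟩
    · rintro rfl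
      rw [map_zero] at hab
      exact (mul_ne_zero hu0 hb0) hab
    · rintro _ ⟨x, rfl, hx⟩
      have h1 := (J.stab hle).le_smul_m hzJ hx
      rw [mem_smul_iff u.ne_zero] at h1
      obtain ⟨c, hc⟩ := (hρ.integer_iff (⟨(u⁻¹ : Un K p), (u⁻¹).2.1⟩ * x)).2 (m_le_V h1)
      refine ⟨b * c, ?_⟩
      rw [Algebra.smul_def, map_mul, hc, map_mul, ← hab]
      ring
  let I' : FractionalIdeal (nonZeroDivisors A) (FractionRing A) := ⟨I, hfrac⟩
  refine ⟨⟨I', fun h0 => ?_⟩, Subtype.ext (Subtype.ext (Submodule.ext fun x => ?_))⟩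
  · obtain ⟨y, hy, hy'⟩ := J.2.2.1
    let y' : locAt D K p.asIdeal p.isPrime := ⟨y, J.2.2.2.1 hy⟩
    have h1 : ρ y' ∈ I' := (hI y').2 hy
    rw [h0, FractionalIdeal.mem_zero_iff] at h1
    exact hy' ((hρ.eq_zero_iff y').1 h1)
  · exact ⟨fun h => (hI ⟨x, h.1⟩).1 h.2, fun h => ⟨J.2.2.2.1 h, (hI ⟨x, _⟩).2 h⟩⟩

theorem pAct_comap (x : Un K p) (I : NZFrac A) :
    pAct p q x (hρ.comap hpq I) =
      hρ.comap hpq (fracAct A ⟨ρ ⟨x, x.2.1⟩, hρ.map_unit_ne_zero x⟩ I) := by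
  refine Subtype.ext (Subtype.ext (Submodule.ext fun y => ?_))
  change y ∈ (x : K) • (hρ.comap hpq I).1.1 ↔ _
  rw [mem_smul_iff x.ne_zero]
  constructor
  · rintro ⟨hy, hy'⟩
    have hyV : y ∈ V K p := mem_V_of_mul (x⁻¹).2.2 hy
    refine ⟨hyV, FractionalIdeal.mem_singleton_mul.2 ⟨_, hy', ?_⟩⟩
    change _ = ρ ⟨x, x.2.1⟩ * _
    rw [← map_mul]
    congr 1
    exact Subtype.ext (mul_inv_cancel_left₀ x.ne_zero y).symm
  · rintro ⟨hy, hy'⟩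
    obtain ⟨z, hz, hz'⟩ := FractionalIdeal.mem_singleton_mul.1 hy'
    refine ⟨mul_mem_V x.inv_mem hy, ?_⟩
    have h1 : ρ ⟨(x : K)⁻¹ * y, mul_mem_V x.inv_mem hy⟩ = z := by
      refine mul_left_cancel₀ (hρ.map_unit_ne_zero x) (Eq.trans ?_ hz')
      rw [← map_mul]
      congr 1
      exact Subtype.ext (mul_inv_cancel_left₀ x.ne_zero y)
    rw [h1]
    exact hz

theorem nonempty_equiv [Finite (MaximalSpectrum D)] [Finite (hiSpec D)] (hρ : IsResidue p q ρ)
    (hpq : p < q) : Nonempty (AFracStar A ≃ {h : HSys K p q // h ≠ ⊤}) := by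
  have hV : ¬ V K p ≤ V K q := not_V_le_V hpq
  let e : NZFrac A ≃o PMod K p q :=
    RelIso.ofSurjective (OrderEmbedding.ofMapLEIff (hρ.comap hV) fun _ _ => comap_le_comap)
      (comap_surjective (hρ := hρ) (hpq := hV) hpq.le)
  refine ⟨(AFracStar.equivEqClo (hρ.not_surjective hV)).trans
    ((EqClo.congr e (fun g => ?_) fun g => ?_).toEquiv.trans
      (HSys.equivEqClo hpq ⟨Mod.ofMax hpq, fun h => ?_⟩).symm)⟩
  · obtain ⟨x, hx⟩ := hρ.exists_unit g.2
    refine ⟨x, fun I => (pAct_comap (hρ := hρ) (hpq := hV) x I).trans ?_⟩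
    have : (⟨ρ ⟨x, x.2.1⟩, hρ.map_unit_ne_zero x⟩ : {x : FractionRing A // x ≠ 0}) = g :=
      Subtype.ext hx
    rw [this]
    rfl
  · exact ⟨_, fun I => pAct_comap (hρ := hρ) (hpq := hV) g I⟩
  · have h1 : m K q = V K p := congrArg Subtype.val h
    exact one_notMem_m (h1 ▸ one_mem_V : (1 : K) ∈ m K q)

end IsResidue

end Transport

section Residue

variable {D : Type*} [CommRing D] [IsDomain D]
variable {p q : PrimeSpectrum D}

theorem disjoint_primeCompl (hpq : p ≤ q) :
    Disjoint (q.asIdeal.primeCompl : Set D) (p.asIdeal : Set D) :=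
  Set.disjoint_left.2 fun _ hq hp => hq (hpq hp)

theorem isDomain_Zring (hpq : p ≤ q) : IsDomain (Zring D q.asIdeal p.asIdeal q.isPrime) := by
  have := IsLocalization.isPrime_of_isPrime_disjoint q.asIdeal.primeCompl
    (locRing D q.asIdeal q.isPrime) p.asIdeal p.isPrime (disjoint_primeCompl hpq)
  exact Ideal.Quotient.isDomain _

/-- The canonical map to the ring `Z(q)`. -/
def toZring (p q : PrimeSpectrum D) : D →+* Zring D q.asIdeal p.asIdeal q.isPrime :=
  (Ideal.Quotient.mk _).comp (algebraMap D (locRing D q.asIdeal q.isPrime))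

theorem toZring_eq_zero_iff (hpq : p ≤ q) {d : D} : toZring p q d = 0 ↔ d ∈ p.asIdeal := by
  rw [toZring, RingHom.comp_apply, Ideal.Quotient.eq_zero_iff_mem]
  have h1 := IsLocalization.under_map_of_isPrime_disjoint q.asIdeal.primeCompl
    (locRing D q.asIdeal q.isPrime) p.isPrime (disjoint_primeCompl hpq)
  conv_rhs => rw [← h1]
  rfl

theorem exists_toZring_mul (a : Zring D q.asIdeal p.asIdeal q.isPrime) :
    ∃ r : D, ∃ s ∉ q.asIdeal, toZring p q s * a = toZring p q r := by
  obtain ⟨a, rfl⟩ := Ideal.Quotient.mk_surjective a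
  obtain ⟨⟨r, s⟩, h⟩ := IsLocalization.surj q.asIdeal.primeCompl a
  refine ⟨r, s, s.2, ?_⟩
  rw [toZring, RingHom.comp_apply, RingHom.comp_apply, ← map_mul, mul_comm, h]

theorem isUnit_toZring {s : D} (hs : s ∉ q.asIdeal) : IsUnit (toZring p q s) :=
  (IsLocalization.map_units (locRing D q.asIdeal q.isPrime)
    (⟨s, hs⟩ : q.asIdeal.primeCompl)).map
    (Ideal.Quotient.mk (Ideal.map (algebraMap D (locRing D q.asIdeal q.isPrime)) p.asIdeal))

variable {K : Type*} [Field K] [Algebra D K] [IsFractionRing D K] [Fact (IsPrufer D K)]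

theorem exists_isResidue (hpq : p ≤ q) [IsDomain (Zring D q.asIdeal p.asIdeal q.isPrime)] :
    ∃ ρ : locAt D K p.asIdeal p.isPrime →+*
      FractionRing (Zring D q.asIdeal p.asIdeal q.isPrime), IsResidue p q ρ := by
  set A := Zring D q.asIdeal p.asIdeal q.isPrime with hA
  let f : D →+* FractionRing A := (algebraMap A (FractionRing A)).comp (toZring p q)
  have hf : ∀ d, f d = 0 ↔ d ∈ p.asIdeal := fun d => by
    rw [← toZring_eq_zero_iff hpq]
    exact map_eq_zero_iff _ (IsFractionRing.injective A (FractionRing A))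
  have hunit : ∀ y : p.asIdeal.primeCompl, IsUnit (f y) := fun y =>
    isUnit_iff_ne_zero.2 fun h => y.2 ((hf _).1 h)
  have : IsLocalization p.asIdeal.primeCompl (locAt D K p.asIdeal p.isPrime) :=
    Localization.subalgebra.isLocalization_subalgebra K _ _
  let ρ : locAt D K p.asIdeal p.isPrime →+* FractionRing A := IsLocalization.lift hunit
  have hρ : ∀ d, ρ (algebraMap D _ d) = f d := IsLocalization.lift_eq hunit
  have hmul : ∀ {x : locAt D K p.asIdeal p.isPrime} {s a : D},
      algebraMap D K s * x = algebraMap D K a → f s * ρ x = f a := by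
    intro x s a h
    rw [← hρ, ← hρ, ← map_mul]
    congr 1
    exact Subtype.ext h
  have hrep : ∀ x : locAt D K p.asIdeal p.isPrime, ∃ s ∉ p.asIdeal, ∃ a,
      algebraMap D K s * x = algebraMap D K a := fun x => mem_V.1 x.2
  have hzero : ∀ x, ρ x = 0 ↔ (x : K) ∈ m K p := by
    intro x
    obtain ⟨s, hs, a, h⟩ := hrep x
    have h1 := hmul h
    have hs0 : f s ≠ 0 := fun h => hs ((hf s).1 h)
    rw [← mul_eq_zero_iff_left hs0, h1, hf]
    refine ⟨fun ha => ⟨s, hs, a, ha, h⟩, fun hx => ?_⟩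
    have h2 : algebraMap D K s * x ∈ m K p := mul_mem_m (algebraMap_mem_V s) hx
    rwa [h, algebraMap_mem_m] at h2
  refine ⟨ρ, fun z => ?_, hzero, fun x => ⟨?_, fun hx => ?_⟩⟩
  · obtain ⟨a, b, hb, rfl⟩ := IsFractionRing.div_surjective (A := A) z
    obtain ⟨r, s, hs, h⟩ := exists_toZring_mul a
    obtain ⟨r', s', hs', h'⟩ := exists_toZring_mul b
    have hsp : f s ≠ 0 := fun h => hs (hpq ((hf s).1 h))
    have hsp' : f s' ≠ 0 := fun h => hs' (hpq ((hf s').1 h))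
    have hb0 : algebraMap A (FractionRing A) b ≠ 0 := by
      simpa using nonZeroDivisors.ne_zero hb
    have e1 : f s * algebraMap A _ a = f r := by
      change algebraMap A _ _ * _ = algebraMap A _ _
      rw [← map_mul, h]
    have e2 : f s' * algebraMap A _ b = f r' := by
      change algebraMap A _ _ * _ = algebraMap A _ _
      rw [← map_mul, h']
    have hr' : f r' ≠ 0 := e2 ▸ mul_ne_zero hsp' hb0
    have hd : s * r' ∉ p.asIdeal := fun h => by
      rw [← hf, map_mul] at h
      exact mul_ne_zero hsp hr' h
    let x : locAt D K p.asIdeal p.isPrime :=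
      IsLocalization.mk' _ (r * s') (⟨s * r', hd⟩ : p.asIdeal.primeCompl)
    refine ⟨x, ?_⟩
    have h1 : f (s * r') * ρ x = f (r * s') := by
      rw [← hρ, ← hρ, ← map_mul, mul_comm]
      congr 1
      exact IsLocalization.mk'_spec _ _ (⟨s * r', hd⟩ : p.asIdeal.primeCompl)
    rw [eq_div_iff hb0]
    refine mul_left_cancel₀ (mul_ne_zero (mul_ne_zero hsp hsp') hr') ?_
    rw [map_mul, map_mul] at h1
    linear_combination (f s' * algebraMap A _ b) * h1 + (f s' * f r) * e2 - (f s' * f r') * e1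
  · rintro ⟨a, ha⟩
    obtain ⟨r, s, hs, h⟩ := exists_toZring_mul a
    have h1 : f s * ρ x = f r := by
      rw [← ha]
      change algebraMap A _ _ * _ = algebraMap A _ _
      rw [← map_mul, h]
    have h2 : ρ (algebraMap D _ s * x - algebraMap D _ r) = 0 := by
      rw [map_sub, map_mul, hρ, hρ, h1, sub_self]
    have h3 : algebraMap D K s * x - algebraMap D K r ∈ V K q :=
      m_le_V_of_le hpq ((hzero _).1 h2)
    have h4 := add_mem h3 (algebraMap_mem_V (K := K) (p := q) r)
    rw [sub_add_cancel] at h4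
    have hsm : algebraMap D K s ∉ m K q := by rwa [algebraMap_mem_m]
    exact mem_V_of_mul hsm h4
  · obtain ⟨s, hs, a, h⟩ := mem_V.1 hx
    have h1 := hmul h
    obtain ⟨u, hu⟩ := isUnit_toZring (p := p) hs
    refine ⟨(u⁻¹ : Aˣ) * toZring p q a, ?_⟩
    have hs0 : f s ≠ 0 := fun h => hs (hpq ((hf s).1 h))
    refine mul_left_cancel₀ hs0 ?_
    rw [h1]
    change algebraMap A _ _ * _ = algebraMap A _ _
    rw [← map_mul, ← hu, Units.mul_inv_cancel_left]

theorem nonempty_AFracStar_equiv [Finite (MaximalSpectrum D)] [Finite (hiSpec D)] (hpq : p < q) :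
    Nonempty (AFracStar (Zring D q.asIdeal p.asIdeal q.isPrime) ≃ {h : HSys K p q // h ≠ ⊤}) := by
  have := isDomain_Zring hpq.le
  obtain ⟨ρ, hρ⟩ := exists_isResidue (K := K) hpq.le
  exact hρ.nonempty_equiv hpq

/-- The operators on a branch, in terms of those at its upper end and of the number of
fractional star operations on the residual valuation ring. -/
theorem nonempty_ESys_orderIso_WT [Finite (MaximalSpectrum D)] [Finite (hiSpec D)] (hpq : p < q)
    {n : ℕ} (hn : omegaAt D q.asIdeal p.asIdeal q.isPrime = n + 1) :
    Nonempty (ESys K p q ≃o WT (NSys K q) n) := by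
  classical
  obtain ⟨e⟩ := nonempty_AFracStar_equiv (K := K) hpq
  have hcard : Nat.card {h : HSys K p q // h ≠ ⊤} = n + 1 := by
    rw [← hn, omegaAt, Nat.card_congr e]
  have hfin : Finite {h : HSys K p q // h ≠ ⊤} :=
    Nat.finite_of_card_ne_zero (by omega)
  have : Finite (HSys K p q) :=
    Finite.of_equiv _ (Equiv.optionSubtypeNe (⊤ : HSys K p q))
  have := Fintype.ofFinite (HSys K p q)
  have hpt : ∀ x : HSys K p q, Nat.card {h : HSys K p q // h ≠ x} = Fintype.card (HSys K p q) - 1 := by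
    intro x
    rw [Nat.card_eq_fintype_card, Fintype.card_subtype_compl, Fintype.card_subtype_eq]
  let _ : LinearOrder {h : HSys K p q // h ≠ ⊥} :=
    { (inferInstance : PartialOrder {h : HSys K p q // h ≠ ⊥}) with
      le_total := fun a b => HSys.le_or_le hpq.le a.1 b.1
      toDecidableLE := Classical.decRel _ }
  have e2 : Fin (n + 1) ≃o {h : HSys K p q // h ≠ ⊥} :=
    monoEquivOfFin _ (by rw [← Nat.card_eq_fintype_card, hpt, ← hpt ⊤, hcard])
  obtain ⟨e3⟩ := nonempty_ESys_orderIso (K := K) hpq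
  have e4 : Fin (n + 1) ≃o Fin n ⊕ₗ PUnit.{1} :=
    monoEquivOfFin _ (by simp [Lex])
  refine ⟨e3.symm.trans ?_⟩
  exact (OrderIso.sumLexCongr (OrderIso.refl _) (e2.symm.trans e4)).trans
    ((OrderIso.sumLexAssoc _ _ _).symm.trans (WithTop.orderIsoSumLexPUnit.symm))

end Residue

section Semistar

variable {D : Type*} [CommRing D] [IsDomain D]
variable {K : Type*} [Field K] [Algebra D K] [IsFractionRing D K]

theorem mem_m_bot {y : K} : y ∈ m K (⊥ : PrimeSpectrum D) ↔ y = 0 := by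
  rw [mem_m]
  constructor
  · rintro ⟨s, hs, a, ha, h⟩
    have ha0 : a = 0 := ha
    rw [ha0, map_zero] at h
    exact (mul_eq_zero.1 h).resolve_left (algebraMap_ne_zero hs)
  · rintro rfl
    exact ⟨1, (⊥ : PrimeSpectrum D).isPrime.one_notMem, 0, zero_mem _, by simp⟩

theorem mem_V_bot (y : K) : y ∈ V K (⊥ : PrimeSpectrum D) := by
  obtain ⟨a, s, hs, rfl⟩ := IsFractionRing.div_surjective (A := D) y
  have hs0 : algebraMap D K s ≠ 0 :=
    IsFractionRing.to_map_ne_zero_of_mem_nonZeroDivisors hs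
  exact mem_V.2 ⟨s, nonZeroDivisors.ne_zero hs, a, mul_div_cancel₀ _ hs0⟩

/-- A nonzero submodule of the quotient field. -/
def Mod.ofNeBot (I : Submodule D K) (hI : I ≠ ⊥) : Mod K (⊥ : PrimeSpectrum D) ∅ :=
  ⟨I, fun y hy => by rw [mem_m_bot.1 hy]; exact zero_mem I, by
    obtain ⟨y, hy, hy0⟩ := I.ne_bot_iff.1 hI
    exact ⟨y, hy, fun h => hy0 (mem_m_bot.1 h)⟩, fun y _ => mem_V_bot y,
    fun t ht => absurd ht (Set.notMem_empty t)⟩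

theorem Mod.ne_bot (J : Mod K (⊥ : PrimeSpectrum D) ∅) : J.1 ≠ ⊥ := fun h => by
  obtain ⟨y, hy, hy'⟩ := J.2.2.1
  rw [h, Submodule.mem_bot] at hy
  exact hy' (mem_m_bot.2 hy)

theorem span_singleton_mul_eq_smul (x : K) (I : Submodule D K) :
    Submodule.span D {x} * I = x • I := by
  ext y
  rw [Submodule.mem_span_singleton_mul, Submodule.mem_smul_pointwise_iff_exists]
  rfl

variable (D K) in
/-- The semistar operation sending every submodule to the quotient field. -/
def Semistar.trivial : Semistar D K where
  toFun _ := ⊤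
  le_star' _ := le_top
  mono' _ _ _ := le_rfl
  idem' _ := rfl
  smul' x hx _ := by
    rw [span_singleton_mul_eq_smul, eq_comm, eq_top_iff]
    intro y _
    rw [mem_smul_iff hx]
    trivial

theorem Semistar.eq_trivial {s : Semistar D K} (h : s.toFun ⊥ ≠ ⊥) : s = Semistar.trivial D K := by
  obtain ⟨y, hy, hy0⟩ := (Submodule.ne_bot_iff _).1 h
  refine ext' (funext fun I => top_le_iff.1 fun z _ => ?_)
  by_cases hz : z = 0
  · rw [hz]; exact zero_mem _
  have h1 := s.smul' (z * y⁻¹) (mul_ne_zero hz (inv_ne_zero hy0)) ⊥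
  rw [Submodule.mul_bot] at h1
  refine s.mono' bot_le ?_
  rw [h1, span_singleton_mul_eq_smul, mem_smul_iff (mul_ne_zero hz (inv_ne_zero hy0))]
  convert hy using 1
  field_simp

variable [Fact (IsPrufer D K)]

open Classical in
/-- The semistar operations fixing the zero module are the equivariant closure operators on the
nonzero submodules. -/
def Semistar.equivNSys : {s : Semistar D K // s.toFun ⊥ = ⊥} ≃ NSys K (⊥ : PrimeSpectrum D) where
  toFun s := ⟨fun J => Mod.ofNeBot (s.1.toFun J.1) fun h =>
      J.ne_bot (le_bot_iff.1 (h ▸ s.1.le_star' J.1)),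
    fun J => s.1.le_star' J.1, fun _ _ h => s.1.mono' h, fun J => Subtype.ext (s.1.idem' J.1),
    fun x J => Subtype.ext <| by
      have := s.1.smul' x x.ne_zero J.1
      rwa [span_singleton_mul_eq_smul, span_singleton_mul_eq_smul] at this⟩
  invFun c := ⟨
    { toFun I := if h : I = ⊥ then ⊥ else (c.1 (Mod.ofNeBot I h)).1
      le_star' I := by
        split_ifs with h
        · exact h.le
        · exact c.2.1 (Mod.ofNeBot I h)
      mono' I J hIJ := by
        by_cases hI : I = ⊥
        · simp [hI]
        · have hJ : J ≠ ⊥ := fun h => hI (le_bot_iff.1 (h ▸ hIJ))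
          rw [dif_neg hI, dif_neg hJ]
          exact c.2.2.1 (show Mod.ofNeBot I hI ≤ Mod.ofNeBot J hJ from hIJ)
      idem' I := by
        by_cases hI : I = ⊥
        · simp [hI]
        · rw [dif_neg hI, dif_neg (c.1 (Mod.ofNeBot I hI)).ne_bot]
          exact congrArg Subtype.val (c.2.2.2.1 (Mod.ofNeBot I hI))
      smul' x hx I := by
        rw [span_singleton_mul_eq_smul, span_singleton_mul_eq_smul]
        by_cases hI : I = ⊥
        · simp [hI]
        · let u : Un K (⊥ : PrimeSpectrum D) := ⟨x, mem_V_bot x, fun h => hx (mem_m_bot.1 h)⟩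
          have hxI : x • I ≠ ⊥ := (act _ ∅ u (Mod.ofNeBot I hI)).ne_bot
          rw [dif_neg hI, dif_neg hxI]
          exact congrArg Subtype.val (c.2.2.2.2 u (Mod.ofNeBot I hI)) },
    dif_pos rfl⟩
  left_inv s := Subtype.ext <| ext' <| funext fun I => by
    by_cases hI : I = ⊥
    · subst hI
      exact (dif_pos rfl).trans s.2.symm
    · exact dif_neg hI
  right_inv c := Subtype.ext <| funext fun J => Subtype.ext (dif_neg J.ne_bot)

theorem card_semistar [Finite (NSys K (⊥ : PrimeSpectrum D))] :
    Nat.card (Semistar D K) = Nat.card (NSys K (⊥ : PrimeSpectrum D)) + 1 := by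
  classical
  have : Finite {s : Semistar D K // s.toFun ⊥ = ⊥} := Finite.of_equiv _ Semistar.equivNSys.symm
  have : Unique {s : Semistar D K // ¬ s.toFun ⊥ = ⊥} :=
    { default := ⟨Semistar.trivial D K, fun h => top_ne_bot h⟩
      uniq := fun s => Subtype.ext (Semistar.eq_trivial s.2) }
  rw [← Nat.card_congr (Equiv.sumCompl fun s : Semistar D K => s.toFun ⊥ = ⊥), Nat.card_sum,
    Nat.card_congr Semistar.equivNSys,
    Nat.card_unique (α := {s : Semistar D K // ¬ s.toFun ⊥ = ⊥})]

end Semistar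

section Model

variable {P : Type u} [PartialOrder P] [Finite P]

/-- `WT` respects order isomorphisms of the lower part. -/
def WT.congr {C C' : Type*} [PartialOrder C] [PartialOrder C'] (e : C ≃o C') (n : ℕ) :
    WT C n ≃o WT C' n :=
  (OrderIso.sumLexCongr e (OrderIso.refl (Fin n))).withTopCongr

/-- The poset of operators at a node of a finite tree, built from the leaves down: the operators
at `x` are described by those at the covers of `x`. -/
theorem exists_model (n : P → ℕ) : ∃ C : P → PartOrd.{u}, (∀ x, Finite (C x)) ∧
    ∀ x, Nonempty (Str (fun y : {y // x ⋖ y} => WT (C y) (n y)) ≃o C x) := by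
  let F (x : P) (C : ∀ y, y > x → PartOrd.{u}) : PartOrd.{u} :=
    PartOrd.of (Str fun y : {y // x ⋖ y} => WT (C y y.2.lt) (n y))
  let C : P → PartOrd.{u} := (wellFounded_gt (α := P)).fix F
  have hC : ∀ x, C x = F x fun y _ => C y := fun x => WellFounded.fix_eq _ F x
  refine ⟨C, fun x => ?_, fun x => ⟨by rw [hC x]⟩⟩
  induction x using (wellFounded_gt (α := P)).induction with
  | _ x ih =>
    rw [hC x]
    have : ∀ y : {y // x ⋖ y}, Finite (C y) := fun y => ih y y.2.lt
    have : ∀ y : {y // x ⋖ y}, Finite (WT (C y) (n y)) := fun y =>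
      inferInstanceAs (Finite (Option (C y ⊕ Fin (n y))))
    exact inferInstanceAs (Finite (Str fun y : {y // x ⋖ y} => WT (C y) (n y)))

end Model

section Tree

variable {D : Type*} [CommRing D] [IsDomain D]
variable {P : Type*} [PartialOrder P]

/-- The prime corresponding to a node. -/
def node (e : hiSpec D ≃o P) (x : P) : PrimeSpectrum D :=
  ⟨(e.symm x).1, mem_hiSpec_prime (e.symm x).2⟩

theorem node_lt_iff {e : hiSpec D ≃o P} {x y : P} : node e x < node e y ↔ x < y :=
  e.symm.lt_iff_lt

theorem child_node_iff {e : hiSpec D ≃o P} {x y : P} : Child (node e x) (node e y) ↔ x ⋖ y := by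
  constructor
  · rintro ⟨-, -, h, h'⟩
    refine ⟨node_lt_iff.1 h, fun z hxz hzy => h' (e.symm z).1 (e.symm z).2 ?_ ?_⟩
    · exact (node_lt_iff (e := e)).2 hxz
    · exact (node_lt_iff (e := e)).2 hzy
  · rintro ⟨h, h'⟩
    refine ⟨(e.symm x).2, (e.symm y).2, (node_lt_iff (e := e)).2 h, fun R hR hxR hRy => ?_⟩
    refine h' (c := e ⟨R, hR⟩) ?_ ?_
    · exact e.symm_apply_lt.1 hxR
    · exact e.lt_symm_apply.1 hRy

theorem node_bot [OrderBot P] (e : hiSpec D ≃o P) : node e ⊥ = ⊥ := by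
  have hbot : (⊥ : Ideal D) ∈ hiSpec D := ⟨Ideal.isPrime_bot, Or.inl rfl⟩
  have : e.symm ⊥ ≤ ⟨⊥, hbot⟩ := e.symm_apply_le.2 bot_le
  exact PrimeSpectrum.ext (le_bot_iff.1 this)

variable {K : Type*} [Field K] [Algebra D K] [IsFractionRing D K] [Fact (IsPrufer D K)]
  [Finite (MaximalSpectrum D)] [Finite (hiSpec D)]

/-- The operators at a node are determined by those at the covers of this node. -/
theorem nonempty_NSys_node_orderIso (e : hiSpec D ≃o P) {x : P} {S : P → Prop}
    (hS : ∀ y, S y ↔ x ⋖ y) {C : {y // S y} → Type*} [∀ y, PartialOrder (C y)]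
    (hC : ∀ y : {y // S y}, Nonempty (NSys K (node e y) ≃o C y)) {n : {y // S y} → ℕ}
    (hn : ∀ y : {y // S y}, omegaAt D (node e y).asIdeal (node e x).asIdeal (node e y).isPrime =
      n y + 1) :
    Nonempty (NSys K (node e x) ≃o Str fun y => WT (C y) (n y)) := by
  have hchild : ∀ y : {y // S y}, Child (node e x) (node e y) := fun y =>
    child_node_iff.2 ((hS y).1 y.2)
  have : Finite P := Finite.of_equiv _ e.toEquiv
  obtain ⟨f⟩ := nonempty_NSys_orderIso (K := K) (p := node e x)
    (q := fun y : {y // S y} => node e y) (e.symm x).2 hchild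
    (fun y z h => Subtype.ext (e.symm.injective (Subtype.ext (congrArg PrimeSpectrum.asIdeal h))))
    (fun r hr => by
      have hr' : r = node e (e ⟨r.asIdeal, hr.2.1⟩) := by
        refine PrimeSpectrum.ext ?_
        simp [node]
      rw [hr', child_node_iff] at hr
      exact ⟨⟨_, (hS _).2 hr⟩, hr'.symm⟩)
  obtain ⟨g⟩ := Classical.nonempty_pi.2 fun y =>
    nonempty_ESys_orderIso_WT (K := K) (hchild y).lt (hn y)
  obtain ⟨h⟩ := Classical.nonempty_pi.2 hC
  exact ⟨f.trans (Str.congr fun y => (g y).trans (WT.congr (h y) _))⟩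

end Tree

theorem isMinNR_iff {P : Type*} [PartialOrder P] [OrderBot P] {x : P} : IsMinNR x ↔ ⊥ ⋖ x := by
  rw [bot_covBy_iff]
  refine ⟨fun h => ⟨h.1, fun y hy => ?_⟩, fun h => ⟨h.1, fun y hy hyx => ?_⟩⟩
  · by_contra hne
    exact hy.ne (h.2 y hne hy.le)
  · exact (h.le_iff.1 hyx).resolve_left hy

/-- Let `𝒫` be a finite rooted homeomorphically irreducible tree
with root `0 = ⊥` and let `p₁, …, p_k` be the minimal elements of `𝒫 \ {0}`. Fixing
the values `ω` at the other elements, the number of semistar operations of a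
semilocal finite-dimensional Prüfer domain `D` with `hiSpec(D) ≅ 𝒫`, as a function
of the values `ω(p₁), …, ω(p_k)`, is a polynomial with rational coefficients of
total degree `k·2^(k-1)`. -/
theorem statement17
    (P : Type*) [PartialOrder P] [Fintype P] [OrderBot P]
    (htree : ∀ x : P, IsChain (· ≤ ·) {y : P | y ≤ x})
    (hhi : ∀ x : P, x = ⊥ ∨ IsMax x ∨
      ∃ S : Set P, (S.Pairwise fun a b => ¬a ≤ b ∧ ¬b ≤ a) ∧ x ∉ S ∧ IsGLB S x)
    (b : P → ℕ) (hb : ∀ x, 0 < b x) :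
    ∃ π : MvPolynomial {x : P // IsMinNR x} ℚ,
      π.totalDegree =
        Nat.card {x : P // IsMinNR x} * 2 ^ (Nat.card {x : P // IsMinNR x} - 1) ∧
      ∀ (a : {x : P // IsMinNR x} → ℕ), (∀ i, 0 < a i) →
        ∀ (D : Type u) (K : Type v) [CommRing D] [IsDomain D] [Field K]
          [Algebra D K] [IsFractionRing D K],
          IsPrufer D K → IsSemilocal D → ringKrullDim D < ⊤ →
          ∀ e : ↥(hiSpec D) ≃o P,
            (∀ (Pp Qq : ↥(hiSpec D)), DirectlyBelow D Qq.1 Pp.1 →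
              ∀ h : IsMinNR (e Pp),
                omegaAt D Pp.1 Qq.1 (mem_hiSpec_prime Pp.2) = a ⟨e Pp, h⟩) →
            (∀ (Pp Qq : ↥(hiSpec D)), DirectlyBelow D Qq.1 Pp.1 →
              ¬IsMinNR (e Pp) →
                omegaAt D Pp.1 Qq.1 (mem_hiSpec_prime Pp.2) = b (e Pp)) →
            (Nat.card (Semistar D K) : ℚ) =
              MvPolynomial.eval (fun i => (a i : ℚ)) π := by
  obtain ⟨C, hfin, hC⟩ := exists_model fun x => b x - 1
  obtain ⟨π, hdeg, hπ⟩ := exists_polynomial_card_str fun x : {x : P // IsMinNR x} => C x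
  refine ⟨π, hdeg, fun a ha D K _ _ _ _ _ hD hsl _ e hωa hωb => ?_⟩
  have : Fact (IsPrufer D K) := ⟨hD⟩
  have : Finite (hiSpec D) := Finite.of_equiv _ e.symm.toEquiv
  have : Finite (MaximalSpectrum D) := by
    have := hsl.to_subtype
    exact Finite.of_injective
      (fun M : MaximalSpectrum D => (⟨M.asIdeal, M.isMaximal⟩ : {I : Ideal D | I.IsMaximal}))
      fun M N h => MaximalSpectrum.ext (congrArg Subtype.val h)
  have hnode : ∀ x : P, x ≠ ⊥ → Nonempty (NSys K (node e x) ≃o C x) := by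
    intro x
    induction x using (wellFounded_gt (α := P)).induction with
    | _ x ih =>
      intro hx
      obtain ⟨f⟩ := nonempty_NSys_node_orderIso (K := K) e (S := fun y => x ⋖ y)
        (fun _ => Iff.rfl) (C := fun y => C y) (n := fun y => b y - 1)
        (fun y => ih y y.2.lt (bot_le.trans_lt y.2.lt).ne') fun y => by
          have h := hωb (e.symm y) (e.symm x) (child_node_iff (e := e).2 y.2) fun h =>
            y.2.lt.ne ((h.2 x hx (y.2.le.trans_eq (e.apply_symm_apply _).symm)).trans
              (e.apply_symm_apply _))
          rw [e.apply_symm_apply] at h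
          rw [Nat.sub_add_cancel (hb y)]
          exact h
      obtain ⟨g⟩ := hC x
      exact ⟨f.trans g⟩
  obtain ⟨f⟩ := nonempty_NSys_node_orderIso (K := K) e (fun _ => isMinNR_iff)
    (C := fun y => C y) (n := fun y => a y - 1) (fun y => hnode y y.2.1) fun y => by
      have hy : IsMinNR (e (e.symm y)) := by rw [e.apply_symm_apply]; exact y.2
      have h := hωa (e.symm y) (e.symm ⊥) (child_node_iff (e := e).2 (isMinNR_iff.1 y.2)) hy
      have hy' : (⟨e (e.symm y), hy⟩ : {x : P // IsMinNR x}) = y :=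
        Subtype.ext (e.apply_symm_apply _)
      rw [hy'] at h
      rw [Nat.sub_add_cancel (ha y)]
      exact h
  rw [node_bot] at f
  have : ∀ y : {x : P // IsMinNR x}, Finite (WT (C y) (a y - 1)) := fun y =>
    inferInstanceAs (Finite (Option (C y ⊕ Fin (a y - 1))))
  have : Finite (NSys K (⊥ : PrimeSpectrum D)) := Finite.of_equiv _ f.symm.toEquiv
  rw [card_semistar, Nat.card_congr f.toEquiv, Nat.cast_add_one, hπ]
  congr 2
  funext i
  rw [← Nat.cast_add_one, Nat.sub_add_cancel (ha i)]

end Paper
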